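/- arXiv:1307.0321 — 3 statements merged into one kernel-verified Lean document; each statement's English description precedes it below -/
import Mathlib

section
/- Let n ≥ 1, k ∈ ℕ, and let f be a real-valued function of class C^k on a neighborhood of 0 in ℝ^{1+n}. Then the trace φ(ȳ) := f(|ȳ|, ȳ) of f on the light cone C_O admits an admissible expansion of order k: there exist homogeneous polynomials P_p of degree p and Q_{p−1} of degree p−1 on ℝⁿ (for 0 ≤ p ≤ k, with Q_{−1} := 0) such that the remainder φ(ȳ) − Σ_{p=0}^{k} (P_p(ȳ) + |ȳ|·Q_{p−1}(ȳ)) is o_k(r^k). -/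
open Filter Topology MeasureTheory

/-- `φ` is `o_m(r^k)` near the origin of `ℝⁿ` (punctured): `φ` is `C^m` on a punctured
ball around `0`, and for every `ℓ ≤ m` one has `‖y‖^(ℓ-k) ‖D^ℓ φ(y)‖ → 0` as `y → 0`,
`y ≠ 0`. -/
def IsLittleOCone (n m : ℕ) (k : ℤ) (φ : EuclideanSpace ℝ (Fin n) → ℝ) : Prop :=
  ∃ ε > (0 : ℝ), ContDiffOn ℝ (m : ℕ∞) φ
      (Metric.ball (0 : EuclideanSpace ℝ (Fin n)) ε \ {0}) ∧
    ∀ ℓ : ℕ, ℓ ≤ m →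
      Tendsto (fun y : EuclideanSpace ℝ (Fin n) =>
          ‖y‖ ^ ((ℓ : ℝ) - (k : ℝ)) * ‖iteratedFDeriv ℝ ℓ φ y‖)
        (𝓝[≠] (0 : EuclideanSpace ℝ (Fin n))) (𝓝 0)

section aux
variable {E F : Type*} [NormedAddCommGroup E] [NormedSpace ℝ E]
  [NormedAddCommGroup F] [NormedSpace ℝ F]

lemma aux_clm {m : ℕ} (G : E → ContinuousMultilinearMap ℝ (fun _ : Fin m => E) F) (x : E)
    (hG : DifferentiableAt ℝ (fderiv ℝ G) x) (a h : E) (u : Fin m → E) :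
    fderiv ℝ (fun y => fderiv ℝ G y a u) x h = fderiv ℝ (fderiv ℝ G) x h a u := by
  have h1 := hG.hasFDerivAt.clm_apply (hasFDerivAt_const a x)
  have h2 := ((ContinuousMultilinearMap.apply ℝ (fun _ : Fin m => E) F u).hasFDerivAt.comp x
    h1).fderiv
  have h3 := congrArg (fun L => L h) h2
  refine h3.trans ?_
  simp

lemma aux_swap (f : E → F) (m : ℕ) : ∀ (x : E) (_ : ContDiffAt ℝ ((m + 1 : ℕ) : ℕ∞) f x)
    (i : Fin m) (v : Fin (m + 1) → E),
    iteratedFDeriv ℝ (m + 1) f x (v ∘ Equiv.swap i.castSucc i.succ)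
      = iteratedFDeriv ℝ (m + 1) f x v := by
  induction m with
  | zero => intro x _ i; exact i.elim0
  | succ m ih =>
    intro x hf i v
    have hd : DifferentiableAt ℝ (iteratedFDeriv ℝ (m + 1) f) x :=
      hf.differentiableAt_iteratedFDeriv (by norm_cast; omega)
    have happ : ∀ (w : Fin (m+1) → E) (h : E), fderiv ℝ (iteratedFDeriv ℝ (m + 1) f) x h w
        = fderiv ℝ (fun y => iteratedFDeriv ℝ (m + 1) f y w) x h := by
      intro w h
      have := ((ContinuousMultilinearMap.apply ℝ (fun _ : Fin (m+1) => E) F w).hasFDerivAt.comp x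
        hd.hasFDerivAt).fderiv
      have h2 : (⇑(ContinuousMultilinearMap.apply ℝ (fun _ : Fin (m+1) => E) F w)
        ∘ iteratedFDeriv ℝ (m + 1) f) = (fun y => iteratedFDeriv ℝ (m + 1) f y w) := rfl
      rw [h2] at this
      rw [this]
      rfl
    refine Fin.cases ?_ (fun j => ?_) i
    · have hd2 : DifferentiableAt ℝ (fderiv ℝ (iteratedFDeriv ℝ m f)) x := by
        have h2 : ContDiffAt ℝ 2 (iteratedFDeriv ℝ m f) x := by
          apply hf.iteratedFDeriv_right
          have h : 2 + m ≤ m + 1 + 1 := by omega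
          have h' : ((2 + m : ℕ) : WithTop ℕ∞) ≤ ((m + 1 + 1 : ℕ) : WithTop ℕ∞) := Nat.cast_le.2 h
          simpa using h'
        exact (h2.fderiv_right (m := 1) (by norm_num)).differentiableAt (by simp)
      have key : ∀ w : Fin (m + 2) → E, iteratedFDeriv ℝ (m + 2) f x w =
          fderiv ℝ (fderiv ℝ (iteratedFDeriv ℝ m f)) x (w 0) (w 1) (fun j => w j.succ.succ) := by
        intro w
        rw [iteratedFDeriv_succ_apply_left, happ]
        simp only [iteratedFDeriv_succ_apply_left]
        have h3 := aux_clm (iteratedFDeriv ℝ m f) x hd2 (Fin.tail w 0) (w 0) (Fin.tail (Fin.tail w))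
        exact h3
      have hs : IsSymmSndFDerivAt ℝ (iteratedFDeriv ℝ m f) x := by
        apply ContDiffAt.isSymmSndFDerivAt (n := 2)
        · apply hf.iteratedFDeriv_right
          have h : 2 + m ≤ m + 1 + 1 := by omega
          have h' : ((2 + m : ℕ) : WithTop ℕ∞) ≤ ((m + 1 + 1 : ℕ) : WithTop ℕ∞) := Nat.cast_le.2 h
          simpa using h'
        · simp
      rw [key, key, hs.eq]
      congr 1
    · have hev : ∀ᶠ y in 𝓝 x, ContDiffAt ℝ ((m + 1 : ℕ) : ℕ∞) f y := by
        have := hf.eventually (by simp)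
        filter_upwards [this] with y hy
        exact hy.of_le (by norm_cast; omega)
      rw [iteratedFDeriv_succ_apply_left, iteratedFDeriv_succ_apply_left, happ, happ]
      have h0 : (v ∘ Equiv.swap j.succ.castSucc j.succ.succ) 0 = v 0 := by
        simp only [Function.comp]
        rw [Equiv.swap_apply_of_ne_of_ne]
        · simp [Fin.ext_iff]
        · simp [Fin.ext_iff]
      have ht : Fin.tail (v ∘ Equiv.swap j.succ.castSucc j.succ.succ)
          = Fin.tail v ∘ Equiv.swap j.castSucc j.succ := by
        ext a
        simp only [Fin.tail, Function.comp]
        congr 1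
        simp only [Equiv.swap_apply_def, Fin.ext_iff]
        split_ifs <;> simp_all
      rw [h0, ht]
      congr 1
      apply Filter.EventuallyEq.fderiv_eq
      filter_upwards [hev] with y hy
      exact ih y hy j _

lemma aux_perm (f : E → F) (m : ℕ) (x : E) (hf : ContDiffAt ℝ (m : ℕ∞) f x)
    (σ : Equiv.Perm (Fin m)) (v : Fin m → E) :
    iteratedFDeriv ℝ m f x (v ∘ σ) = iteratedFDeriv ℝ m f x v := by
  cases m with
  | zero => congr 1; ext i; exact i.elim0
  | succ m =>
    have hσ : σ ∈ Submonoid.closure (Set.range fun i : Fin m => Equiv.swap i.castSucc i.succ) := by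
      rw [Equiv.Perm.mclosure_swap_castSucc_succ]; trivial
    induction hσ using Submonoid.closure_induction generalizing v with
    | mem σ h =>
      obtain ⟨i, rfl⟩ := h
      exact aux_swap f m x hf i v
    | one => rfl
    | mul σ τ _ _ h1 h2 =>
      have : v ∘ ⇑(σ * τ) = (v ∘ σ) ∘ τ := rfl
      rw [this, h2, h1]

noncomputable def auxP (f : E → F) (k : ℕ) : FormalMultilinearSeries ℝ E F := fun j =>
  if j ≤ k then ((j.factorial : ℝ)⁻¹) • iteratedFDeriv ℝ j f 0 else 0

lemma aux_taylor [CompleteSpace F] (f : E → F) (k : ℕ) (hf : ContDiffAt ℝ (k : ℕ∞) f 0) :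
    ContDiff ℝ (k : ℕ∞) (fun x => ∑ j ∈ Finset.range (k + 1), auxP f k j (fun _ => x)) ∧
    ∀ j ≤ k, iteratedFDeriv ℝ j (fun x => ∑ j ∈ Finset.range (k + 1), auxP f k j (fun _ => x)) 0
      = iteratedFDeriv ℝ j f 0 := by
  constructor
  · apply ContDiff.sum
    intro j _
    exact (auxP f k j).contDiff.comp (contDiff_pi.2 fun _ => contDiff_id)
  · intro j hj
    have h : HasFiniteFPowerSeriesOnBall
        (fun x => ∑ j ∈ Finset.range (k + 1), auxP f k j (fun _ => x)) (auxP f k) 0 (k+1) ⊤ := by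
      apply HasFiniteFPowerSeriesOnBall.mk'
      · intro m hm
        simp only [auxP]
        rw [if_neg (by omega)]
      · simp
      · intro y _; simp
    ext v
    rw [h.toHasFPowerSeriesOnBall.iteratedFDeriv_eq_sum_of_completeSpace]
    have : ∀ σ : Equiv.Perm (Fin j), auxP f k j (fun i => v (σ i))
        = ((j.factorial : ℝ)⁻¹) • iteratedFDeriv ℝ j f 0 v := by
      intro σ
      rw [← aux_perm f j 0 (hf.of_le (by exact_mod_cast hj)) σ v]
      simp only [auxP, if_pos hj]
      rfl
    simp only [this, Finset.sum_const, Finset.card_univ, Fintype.card_perm, Fintype.card_fin]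
    rw [← Nat.cast_smul_eq_nsmul ℝ, smul_smul, mul_inv_cancel₀, one_smul]
    exact_mod_cast j.factorial_ne_zero

lemma aux_small (g : E → F) (k : ℕ) (hg : ContDiffAt ℝ (k : ℕ∞) g 0)
    (h0 : ∀ j ≤ k, iteratedFDeriv ℝ j g 0 = 0) (d : ℕ) (hd : d ≤ k) :
    ∀ c > 0, ∀ᶠ x in 𝓝 (0 : E), ‖iteratedFDeriv ℝ (k - d) g x‖ ≤ c * ‖x‖ ^ d := by
  induction d with
  | zero =>
    intro c hc
    have hct : ContinuousAt (iteratedFDeriv ℝ (k - 0) g) 0 :=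
      (hg.iteratedFDeriv_right (m := 0) (i := k) (by simp)).continuousAt
    have := hct.norm.tendsto
    rw [h0 (k - 0) (by simp), norm_zero] at this
    filter_upwards [this.eventually (gt_mem_nhds hc)] with x hx
    simpa using hx.le
  | succ d ih =>
    intro c hc
    have hev := (ih (by omega) c hc).and (hg.eventually (by simp))
    obtain ⟨δ, hδ, hb⟩ := Metric.eventually_nhds_iff_ball.1 hev
    filter_upwards [Metric.ball_mem_nhds 0 hδ] with x hx
    have hsub : Metric.closedBall (0:E) ‖x‖ ⊆ Metric.ball 0 δ :=
      Metric.closedBall_subset_ball (by simpa using hx)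
    have := (convex_closedBall (0:E) ‖x‖).norm_image_sub_le_of_norm_fderiv_le (𝕜 := ℝ)
      (f := iteratedFDeriv ℝ (k - (d+1)) g) (C := c * ‖x‖ ^ d) (x := 0) (y := x)
      (fun y hy => (hb y (hsub hy)).2.differentiableAt_iteratedFDeriv
        (by have h : k - (d + 1) < k := by omega
            exact Nat.cast_lt.2 h))
      (fun y hy => by
        rw [norm_fderiv_iteratedFDeriv]
        have h1 := (hb y (hsub hy)).1
        have e : k - (d + 1) + 1 = k - d := by omega
        rw [e]
        refine h1.trans ?_
        have : ‖y‖ ≤ ‖x‖ := by simpa using hy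
        gcongr)
      (by simp) (by simp)
    rw [h0 _ (by omega)] at this
    simpa [pow_succ, mul_assoc] using this

lemma aux_scale (f : E → F) (c : ℝ) (hc : c ≠ 0) (i : ℕ) (x : E) :
    iteratedFDeriv ℝ i (fun z => f (c • z)) x = c ^ i • iteratedFDeriv ℝ i f (c • x) := by
  have := (ContinuousLinearEquiv.smulLeft (R₁ := ℝ) (M₁ := E) (Units.mk0 c hc)).iteratedFDerivWithin_comp_right
    f (uniqueDiffOn_univ) (x := x) (Set.mem_univ _) i
  simp only [Set.preimage_univ, iteratedFDerivWithin_univ] at this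
  refine Eq.trans this ?_
  ext v
  have h2 := (iteratedFDeriv ℝ i f (c • x)).map_smul_univ (fun _ => c) v
  simpa using h2

end aux

section aux2
open MvPolynomial

/-- functions of the form `P + r Q` with `P`, `Q` homogeneous of degree `j`, `j-1` -/
def AuxAdm (n j : ℕ) (φ : EuclideanSpace ℝ (Fin n) → ℝ) : Prop :=
  ∃ P Q : MvPolynomial (Fin n) ℝ, P.IsHomogeneous j ∧ (j = 0 → Q = 0) ∧ Q.IsHomogeneous (j - 1) ∧
    ∀ y, φ y = eval (fun i => y i) P + ‖y‖ * eval (fun i => y i) Q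

lemma AuxAdm.add {n j : ℕ} {φ ψ : EuclideanSpace ℝ (Fin n) → ℝ} (h : AuxAdm n j φ)
    (h' : AuxAdm n j ψ) : AuxAdm n j (fun y => φ y + ψ y) := by
  obtain ⟨P, Q, hP, h0, hQ, e⟩ := h
  obtain ⟨P', Q', hP', h0', hQ', e'⟩ := h'
  refine ⟨P + P', Q + Q', hP.add hP', fun hj => by simp [h0 hj, h0' hj], hQ.add hQ', fun y => ?_⟩
  simp only [e, e']; simp; ring

lemma AuxAdm.zero (n j : ℕ) : AuxAdm n j (fun _ => 0) :=
  ⟨0, 0, isHomogeneous_zero _ _ _, fun _ => rfl, isHomogeneous_zero _ _ _, by simp⟩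

lemma AuxAdm.sum {n j : ℕ} {ι : Type*} (s : Finset ι) {φ : ι → EuclideanSpace ℝ (Fin n) → ℝ}
    (h : ∀ i, AuxAdm n j (φ i)) : AuxAdm n j (fun y => ∑ i ∈ s, φ i y) := by
  classical
  induction s using Finset.induction_on with
  | empty => simpa using AuxAdm.zero n j
  | insert a s ha ih => simpa [Finset.sum_insert ha] using (h a).add ih

lemma AuxAdm.coord {n j : ℕ} {φ : EuclideanSpace ℝ (Fin n) → ℝ} (h : AuxAdm n j φ) (i : Fin n) :
    AuxAdm n (j + 1) (fun y => y i * φ y) := by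
  obtain ⟨P, Q, hP, h0, hQ, e⟩ := h
  refine ⟨X i * P, X i * Q, ?_, by simp, ?_, fun y => ?_⟩
  · rw [add_comm]; exact (isHomogeneous_X ℝ i).mul hP
  · rcases j with _ | j
    · rw [h0 rfl, mul_zero]; exact isHomogeneous_zero _ _ _
    · have := (isHomogeneous_X ℝ i).mul hQ
      convert this using 1
      omega
  · simp only [e]; simp; ring

lemma AuxAdm.rad {n j : ℕ} {φ : EuclideanSpace ℝ (Fin n) → ℝ} (h : AuxAdm n j φ) :
    AuxAdm n (j + 1) (fun y => ‖y‖ * φ y) := by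
  obtain ⟨P, Q, hP, h0, hQ, e⟩ := h
  refine ⟨(∑ i, X i ^ 2) * Q, P, ?_, by simp, hP, fun y => ?_⟩
  · rcases j with _ | j
    · rw [h0 rfl, mul_zero]; exact isHomogeneous_zero _ _ _
    · have h2 : (∑ i : Fin n, (X i : MvPolynomial (Fin n) ℝ) ^ 2).IsHomogeneous 2 :=
        IsHomogeneous.sum _ _ _ fun i _ => (isHomogeneous_X ℝ i).pow 2
      have := h2.mul hQ
      convert this using 1
      omega
  · simp only [e]
    have : ‖y‖ ^ 2 = ∑ i, y i ^ 2 := by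
      rw [EuclideanSpace.norm_sq_eq]; simp
    simp [← this]; ring

lemma AuxAdm.multilinear {n j : ℕ}
    (A : ContinuousMultilinearMap ℝ (fun _ : Fin j => ℝ × EuclideanSpace ℝ (Fin n)) ℝ) :
    AuxAdm n j (fun y => A (fun _ => (‖y‖, y))) := by
  induction j with
  | zero =>
    refine ⟨C (A (fun _ => 0)), 0, isHomogeneous_C _ _, by simp, isHomogeneous_zero _ _ _, fun y => ?_⟩
    simp only [eval_C, map_zero, mul_zero, add_zero]
    congr 1; funext i; exact i.elim0
  | succ j ih =>
    have key : ∀ y : EuclideanSpace ℝ (Fin n), A (fun _ => (‖y‖, y)) =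
        ‖y‖ * A.curryLeft (1, 0) (fun _ => (‖y‖, y)) +
        ∑ i, y i * A.curryLeft (0, EuclideanSpace.single i 1) (fun _ => (‖y‖, y)) := by
      intro y
      have h1 : A (fun _ => (‖y‖, y)) = A.curryLeft (‖y‖, y) (fun _ => (‖y‖, y)) := by
        rw [ContinuousMultilinearMap.curryLeft_apply]
        congr 1; ext1 i; refine Fin.cases ?_ (fun i => ?_) i <;> simp
      have h2 : ((‖y‖, y) : ℝ × EuclideanSpace ℝ (Fin n)) =
          ‖y‖ • ((1 : ℝ), (0 : EuclideanSpace ℝ (Fin n))) +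
          ∑ i, y i • ((0 : ℝ), (EuclideanSpace.single i 1 : EuclideanSpace ℝ (Fin n))) := by
        ext a
        · simp [Prod.fst_sum]
        · simp [Prod.snd_sum, Pi.single_apply]
      have h3 := congrArg (fun x => A.curryLeft x (fun _ => (‖y‖, y))) h2
      simp only [map_add, map_sum, map_smul, add_apply,
        sum_apply, smul_apply, smul_eq_mul] at h3
      rw [h1, h3]
    simp only [key]
    exact (ih _).rad.add (AuxAdm.sum _ fun i => (ih _).coord i)

end aux2

section aux3

lemma aux_gamma_smooth {n : ℕ} (y : EuclideanSpace ℝ (Fin n)) (hy : y ≠ 0) (m : ℕ∞) :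
    ContDiffAt ℝ m (fun z : EuclideanSpace ℝ (Fin n) => (‖z‖, z)) y :=
  (contDiffAt_norm ℝ hy).prodMk contDiffAt_id

lemma aux_gamma_bound (n k : ℕ) : ∃ M : ℝ, 1 ≤ M ∧ ∀ i ≤ k, ∀ z : EuclideanSpace ℝ (Fin n),
    ‖z‖ = 1 → ‖iteratedFDeriv ℝ i (fun z : EuclideanSpace ℝ (Fin n) => (‖z‖, z)) z‖ ≤ M := by
  induction k with
  | zero =>
    refine ⟨1, le_rfl, fun i hi z hz => ?_⟩
    obtain rfl : i = 0 := by omega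
    simp [Prod.norm_def, hz]
  | succ k ih =>
    obtain ⟨M, hM, h⟩ := ih
    have hc : ContinuousOn (iteratedFDeriv ℝ (k + 1)
        (fun z : EuclideanSpace ℝ (Fin n) => (‖z‖, z))) (Metric.sphere 0 1) := by
      intro z hz
      have hz0 : z ≠ 0 := by rintro rfl; simp at hz
      exact ((aux_gamma_smooth z hz0 (k + 1 : ℕ)).iteratedFDeriv_right (m := 0) (i := k + 1)
        (by simp)).continuousAt.continuousWithinAt
    obtain ⟨M', h'⟩ := (isCompact_sphere (0 : EuclideanSpace ℝ (Fin n)) 1).exists_bound_of_continuousOn hc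
    refine ⟨max M M', le_max_of_le_left hM, fun i hi z hz => ?_⟩
    rcases Nat.lt_or_ge k i with hik | hik
    · obtain rfl : i = k + 1 := by omega
      exact (h' z (by simpa using hz)).trans (le_max_right _ _)
    · exact (h i hik z hz).trans (le_max_left _ _)

lemma aux_gamma_norm {n : ℕ} (z : EuclideanSpace ℝ (Fin n)) :
    ‖((‖z‖, z) : ℝ × EuclideanSpace ℝ (Fin n))‖ = ‖z‖ := by
  simp [Prod.norm_def]

lemma aux_estimate {n k : ℕ} (g : ℝ × EuclideanSpace ℝ (Fin n) → ℝ) (δ : ℝ)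
    (hg : ContDiffOn ℝ (k : ℕ∞) g (Metric.ball 0 δ)) (M : ℝ) (hM1 : 1 ≤ M)
    (hM : ∀ i ≤ k, ∀ z : EuclideanSpace ℝ (Fin n),
      ‖z‖ = 1 → ‖iteratedFDeriv ℝ i (fun z : EuclideanSpace ℝ (Fin n) => (‖z‖, z)) z‖ ≤ M)
    (y : EuclideanSpace ℝ (Fin n)) (hy : y ≠ 0) (hyδ : ‖y‖ < δ) (c : ℝ)
    (hc : ∀ i ≤ k, ‖iteratedFDeriv ℝ i g (‖y‖, y)‖ ≤ c * ‖y‖ ^ (k - i)) (l : ℕ) (hl : l ≤ k) :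
    ‖y‖ ^ l * ‖iteratedFDeriv ℝ l (fun z => g (‖z‖, z)) y‖
      ≤ l.factorial * (c * ‖y‖ ^ k) * M ^ l := by
  set r := ‖y‖ with hr
  have hr0 : 0 < r := norm_pos_iff.2 hy
  set t : Set (ℝ × EuclideanSpace ℝ (Fin n)) := Metric.ball 0 (δ / r) with ht
  set s : Set (EuclideanSpace ℝ (Fin n)) := Metric.ball 0 (δ / r) \ {0} with hs
  have hso : IsOpen s := Metric.isOpen_ball.sdiff isClosed_singleton
  have hto : IsOpen t := Metric.isOpen_ball
  set z : EuclideanSpace ℝ (Fin n) := r⁻¹ • y with hz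
  have hzn : ‖z‖ = 1 := by
    rw [hz, norm_smul, norm_inv, Real.norm_of_nonneg hr0.le, ← hr, inv_mul_cancel₀ hr0.ne']
  have hrz : r • z = y := by rw [hz, smul_smul, mul_inv_cancel₀ hr0.ne', one_smul]
  have hrG : r • ((‖z‖, z) : ℝ × EuclideanSpace ℝ (Fin n)) = (r, y) := by
    rw [Prod.smul_mk, hrz, hzn, smul_eq_mul, mul_one]
  have hzs : z ∈ s := by
    refine ⟨?_, ?_⟩
    · rw [mem_ball_zero_iff, hzn, lt_div_iff₀ hr0]; linarith
    · intro h
      have : z = 0 := h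
      rw [this, norm_zero] at hzn
      exact zero_ne_one hzn
  have hmaps : Set.MapsTo (fun z : EuclideanSpace ℝ (Fin n) => (‖z‖, z)) s t := by
    intro x hx
    rw [ht, mem_ball_zero_iff, aux_gamma_norm]
    simpa using hx.1
  have hgs : ContDiffOn ℝ (k : ℕ∞) (fun x => g (r • x)) t := by
    refine hg.comp (contDiff_const_smul r).contDiffOn ?_
    intro x hx
    rw [ht, mem_ball_zero_iff, lt_div_iff₀ hr0] at hx
    rw [mem_ball_zero_iff, norm_smul, Real.norm_of_nonneg hr0.le]
    linarith
  have hGs : ContDiffOn ℝ (k : ℕ∞) (fun z : EuclideanSpace ℝ (Fin n) => (‖z‖, z)) s := by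
    intro x hx
    exact (aux_gamma_smooth x hx.2 k).contDiffWithinAt
  have main := norm_iteratedFDerivWithin_comp_le (n := l) (C := c * r ^ k) (D := M) hgs hGs
    (Nat.cast_le.2 hl) hto.uniqueDiffOn hso.uniqueDiffOn hmaps hzs
    (by
      intro i hi
      rw [iteratedFDerivWithin_of_isOpen i hto (hmaps hzs), aux_scale g r hr0.ne', hrG, norm_smul,
        norm_pow, Real.norm_of_nonneg hr0.le]
      have h1 := hc i (hi.trans hl)
      have h2 : r ^ k = r ^ i * r ^ (k - i) := by rw [← pow_add]; congr 1; omega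
      calc _ ≤ r ^ i * (c * r ^ (k - i)) := by gcongr
        _ = _ := by rw [h2]; ring)
    (by
      intro i hi1 hi
      rw [iteratedFDerivWithin_of_isOpen i hso hzs]
      exact (hM i (hi.trans hl) z hzn).trans (le_self_pow₀ hM1 (by omega)))
  rw [iteratedFDerivWithin_of_isOpen l hso hzs] at main
  have hfun : ((fun x => g (r • x)) ∘ fun z : EuclideanSpace ℝ (Fin n) => (‖z‖, z))
      = fun x => (fun z : EuclideanSpace ℝ (Fin n) => g (‖z‖, z)) (r • x) := by
    funext x
    simp [norm_smul, Real.norm_of_nonneg hr0.le]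
  rw [hfun, aux_scale (fun z : EuclideanSpace ℝ (Fin n) => g (‖z‖, z)) r hr0.ne' l z, hrz, norm_smul, norm_pow, Real.norm_of_nonneg hr0.le] at main
  exact main

end aux3

/-- the trace `ȳ ↦ f(|ȳ|, ȳ)` on the light cone of a `C^k` function `f`
defined near `0` in `ℝ^{1+n}` admits an admissible expansion of order `k`, with
remainder `o_k(r^k)`. -/
theorem trace_admits_admissible_expansion
    (n k : ℕ) (hn : 1 ≤ n)
    (f : ℝ × EuclideanSpace ℝ (Fin n) → ℝ) (ε : ℝ) (hε : 0 < ε)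
    (hf : ContDiffOn ℝ (k : ℕ∞) f (Metric.ball (0 : ℝ × EuclideanSpace ℝ (Fin n)) ε)) :
    ∃ P Q : ℕ → MvPolynomial (Fin n) ℝ,
      (∀ p, p ≤ k → (P p).IsHomogeneous p) ∧
      Q 0 = 0 ∧
      (∀ p, 1 ≤ p → p ≤ k → (Q p).IsHomogeneous (p - 1)) ∧
      IsLittleOCone n k (k : ℤ) (fun y =>
        f (‖y‖, y) - ∑ p ∈ Finset.range (k + 1),
          (MvPolynomial.eval (fun i => y i) (P p)
            + ‖y‖ * MvPolynomial.eval (fun i => y i) (Q p))) := by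
  have hball : Metric.ball (0 : ℝ × EuclideanSpace ℝ (Fin n)) ε ∈ 𝓝 0 := Metric.ball_mem_nhds 0 hε
  have hf0 : ContDiffAt ℝ (k : ℕ∞) f 0 := hf.contDiffAt hball
  obtain ⟨hT, hTd⟩ := aux_taylor f k hf0
  choose P Q hP hQ0 hQ hPQ using fun j => AuxAdm.multilinear (auxP f k j)
  refine ⟨P, Q, fun p _ => hP p, hQ0 0 rfl, fun p _ _ => hQ p, ?_⟩
  set T : ℝ × EuclideanSpace ℝ (Fin n) → ℝ :=
    fun x => ∑ j ∈ Finset.range (k + 1), auxP f k j (fun _ => x) with hTdef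
  have hfun : (fun y : EuclideanSpace ℝ (Fin n) => f (‖y‖, y) - ∑ p ∈ Finset.range (k + 1),
          (MvPolynomial.eval (fun i => y i) (P p)
            + ‖y‖ * MvPolynomial.eval (fun i => y i) (Q p))) = fun y => (f - T) (‖y‖, y) := by
    funext y
    simp only [← hPQ]
    rfl
  rw [hfun]
  have hg : ContDiffOn ℝ (k : ℕ∞) (f - T) (Metric.ball 0 ε) := hf.sub hT.contDiffOn
  have hg0 : ContDiffAt ℝ (k : ℕ∞) (f - T) 0 := hg.contDiffAt hball
  have hgd : ∀ j ≤ k, iteratedFDeriv ℝ j (f - T) 0 = 0 := by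
    intro j hj
    rw [iteratedFDeriv_sub_apply (hf0.of_le (Nat.cast_le.2 hj))
      (hT.contDiffAt.of_le (Nat.cast_le.2 hj)), hTd j hj, sub_self]
  obtain ⟨M, hM1, hM⟩ := aux_gamma_bound n k
  refine ⟨ε, hε, ?_, ?_⟩
  · intro y hy
    have hmem : ((‖y‖, y) : ℝ × EuclideanSpace ℝ (Fin n)) ∈ Metric.ball 0 ε := by
      rw [mem_ball_zero_iff, aux_gamma_norm]
      simpa using hy.1
    exact (ContDiffAt.comp (f := fun z : EuclideanSpace ℝ (Fin n) => (‖z‖, z)) y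
      (hg.contDiffAt (Metric.isOpen_ball.mem_nhds hmem)) (aux_gamma_smooth y hy.2 k)).contDiffWithinAt
  · intro l hl
    rw [Metric.tendsto_nhds]
    intro η hη
    set K : ℝ := l.factorial * M ^ l with hK
    have hK0 : 0 < K := by positivity
    set c : ℝ := η / (2 * K) with hcdef
    have hc : 0 < c := by positivity
    have hev : ∀ᶠ x in 𝓝 (0 : ℝ × EuclideanSpace ℝ (Fin n)), ∀ i ∈ Finset.range (k + 1),
        ‖iteratedFDeriv ℝ i (f - T) x‖ ≤ c * ‖x‖ ^ (k - i) := by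
      rw [Filter.eventually_all_finset]
      intro i hi
      have hik : i ≤ k := by simpa [Nat.lt_succ_iff] using hi
      have := aux_small (f - T) k hg0 hgd (k - i) (by omega) c hc
      rwa [Nat.sub_sub_self hik] at this
    have hcont : Tendsto (fun y : EuclideanSpace ℝ (Fin n) => (‖y‖, y)) (𝓝 0) (𝓝 0) := by
      have : Continuous (fun y : EuclideanSpace ℝ (Fin n) => (‖y‖, y)) := by fun_prop
      have h := this.tendsto 0
      rw [norm_zero] at h
      exact h
    have hev2 := (hcont.eventually hev).and (Metric.ball_mem_nhds (0 : EuclideanSpace ℝ (Fin n)) hε)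
    filter_upwards [hev2.filter_mono nhdsWithin_le_nhds, self_mem_nhdsWithin] with y hy hy0
    have hy0' : y ≠ 0 := hy0
    have hr0 : 0 < ‖y‖ := norm_pos_iff.2 hy0'
    have est := aux_estimate (f - T) ε hg M hM1 hM y hy0' (by simpa using hy.2) c
      (fun i hi => by
        have := hy.1 i (by simpa [Nat.lt_succ_iff] using hi)
        rwa [aux_gamma_norm] at this) l hl
    rw [Real.dist_eq, sub_zero, abs_of_nonneg (by positivity), Int.cast_natCast,
      Real.rpow_sub hr0, Real.rpow_natCast, Real.rpow_natCast, div_mul_eq_mul_div,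
      div_lt_iff₀ (by positivity)]
    refine est.trans_lt ?_
    have h1 : (l.factorial : ℝ) * (c * ‖y‖ ^ k) * M ^ l = (K * c) * ‖y‖ ^ k := by rw [hK]; ring
    have h2 : K * c = η / 2 := by rw [hcdef]; field_simp
    rw [h1, h2]
    have : 0 < ‖y‖ ^ k := by positivity
    nlinarith
end

section
/- Let a, b_i, c_{ij} (i, j = 1, 2, 3) be C^∞ real functions on a neighborhood of 0 in ℝ⁴, and define h on a punctured neighborhood of 0 in ℝ³ by h(ȳ) := a(|ȳ|, ȳ) + 2 Σ_i b_i(|ȳ|, ȳ) Θ^i + Σ_{i,j} c_{ij}(|ȳ|, ȳ) Θ^i Θ^j, where Θ := ȳ/|ȳ|. Let α > 0 and β = (β₀, β₁, β₂, β₃) ∈ ℝ⁴. Then there exist δ > 0 and a unique continuous function φ : {ȳ ∈ ℝ³ : 0 < |ȳ| < δ} → ℝ such that for every unit vector Θ ∈ S² the map r ↦ φ(rΘ) is C¹ on (0, δ) with (d/dr) φ(rΘ) = φ(rΘ)² + (1/2) h(rΘ) and φ(rΘ) → α^{−1}(β₀ + Σ_i β_i Θ^i) as r → 0⁺. Moreover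 the function θ̄(ȳ) := α · exp(∫₀^{|ȳ|} φ(sΘ) ds) is the trace on the light cone of a C^∞ function θ defined on a neighborhood of 0 in ℝ⁴ with θ(0) = α. -/
open Filter Topology MeasureTheory

/-- The source term `h(ȳ) = a(|ȳ|,ȳ) + 2 Σᵢ bᵢ(|ȳ|,ȳ) Θⁱ + Σᵢⱼ cᵢⱼ(|ȳ|,ȳ) Θⁱ Θʲ`,
with `Θ = ȳ/|ȳ|`, obtained by restricting `r² S₁₁` to the light cone. -/
noncomputable def coneSource
    (a : ℝ × EuclideanSpace ℝ (Fin 3) → ℝ)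
    (b : Fin 3 → ℝ × EuclideanSpace ℝ (Fin 3) → ℝ)
    (c : Fin 3 → Fin 3 → ℝ × EuclideanSpace ℝ (Fin 3) → ℝ)
    (y : EuclideanSpace ℝ (Fin 3)) : ℝ :=
  a (‖y‖, y) + 2 * ∑ i, b i (‖y‖, y) * (y i / ‖y‖)
    + ∑ i, ∑ j, c i j (‖y‖, y) * (y i / ‖y‖) * (y j / ‖y‖)

section core
set_option linter.unusedSectionVars false
variable {E : Type*} [NormedAddCommGroup E] [NormedSpace ℝ E]

/-- currying -/
noncomputable def rcCur (f : ℝ × E → ℝ) (hf : Continuous f) : C(E, C(unitInterval, ℝ)) :=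
  ContinuousMap.curry ⟨fun p : E × unitInterval => f ((p.2 : ℝ), p.1), by fun_prop⟩

theorem rcCur_apply (f : ℝ × E → ℝ) (hf : Continuous f) (x : E) (s : unitInterval) :
    rcCur f hf x s = f ((s : ℝ), x) := rfl

theorem rcPartial_contDiff (f : ℝ × E → ℝ) (hf : ContDiff ℝ (⊤ : ℕ∞) f) (y : E) :
    ContDiff ℝ (⊤ : ℕ∞) (fun z : ℝ × E => fderiv ℝ f z (0, y)) := by
  have h : ContDiff ℝ (⊤ : ℕ∞) (fderiv ℝ f) := hf.fderiv_right (by simp)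
  exact h.clm_apply contDiff_const

theorem rcCur_hasFDerivAt [FiniteDimensional ℝ E] (f : ℝ × E → ℝ) (hf : ContDiff ℝ (⊤ : ℕ∞) f)
    (x : E) :
    ∃ L : E →L[ℝ] C(unitInterval, ℝ),
      (∀ y, L y = rcCur _ (rcPartial_contDiff f hf y).continuous x) ∧
      HasFDerivAt (fun x => rcCur f hf.continuous x) L x := by
  let L0 : E →ₗ[ℝ] C(unitInterval, ℝ) :=
    { toFun := fun y => rcCur _ (rcPartial_contDiff f hf y).continuous x
      map_add' := by
        intro y z
        ext s
        simp only [rcCur_apply, ContinuousMap.add_apply, ← map_add, Prod.mk_add_mk, add_zero]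
      map_smul' := by
        intro c y
        ext s
        simp only [rcCur_apply, ContinuousMap.smul_apply, RingHom.id_apply, ← map_smul,
          Prod.smul_mk, smul_zero] }
  refine ⟨LinearMap.toContinuousLinearMap L0, fun y => rfl, ?_⟩
  have hc : Continuous (fderiv ℝ f) := hf.continuous_fderiv (by simp)
  let G : C(E, C(unitInterval, E →L[ℝ] ℝ)) :=
    ContinuousMap.curry ⟨fun p : E × unitInterval =>
      (fderiv ℝ f ((p.2 : ℝ), p.1)).comp (ContinuousLinearMap.inr ℝ ℝ E), by fun_prop⟩
  have hG : ∀ z s, G z s = (fderiv ℝ f ((s : ℝ), z)).comp (ContinuousLinearMap.inr ℝ ℝ E) :=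
    fun _ _ => rfl
  rw [hasFDerivAt_iff_isLittleO, Asymptotics.isLittleO_iff]
  intro ε hε
  have h1 : ∀ᶠ z in 𝓝 x, dist (G z) (G x) < ε :=
    (Metric.tendsto_nhds.1 (G.continuous.tendsto x)) ε hε
  obtain ⟨d, hd, hball⟩ := Metric.eventually_nhds_iff_ball.1 h1
  filter_upwards [Metric.ball_mem_nhds x hd] with z hz
  rw [ContinuousMap.norm_le _ (by positivity)]
  intro s
  have hder : ∀ w ∈ Metric.ball x d,
      HasFDerivWithinAt (fun w => f ((s : ℝ), w)) (G w s) (Metric.ball x d) w := by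
    intro w _
    have h2 : HasFDerivAt f (fderiv ℝ f ((s : ℝ), w)) ((s : ℝ), w) :=
      (hf.differentiable (by simp) _).hasFDerivAt
    exact (h2.comp w (hasFDerivAt_prodMk_right (s : ℝ) w)).hasFDerivWithinAt
  have hbd : ∀ w ∈ Metric.ball x d, ‖G w s - G x s‖ ≤ ε := by
    intro w hw
    rw [← dist_eq_norm]
    exact (ContinuousMap.dist_apply_le_dist s).trans (hball w hw).le
  have := (convex_ball x d).norm_image_sub_le_of_norm_hasFDerivWithin_le' hder hbd
    (Metric.mem_ball_self hd) hz
  simpa [hG, rcCur_apply, L0] using this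

theorem rcCur_contDiff_nat [FiniteDimensional ℝ E] (n : ℕ) :
    ∀ (f : ℝ × E → ℝ) (hf : ContDiff ℝ (⊤ : ℕ∞) f),
      ContDiff ℝ n (fun x => rcCur f hf.continuous x) := by
  induction n with
  | zero =>
    intro f hf
    exact contDiff_zero.2 (rcCur f hf.continuous).continuous
  | succ n ih =>
    intro f hf
    have : ((n + 1 : ℕ) : WithTop ℕ∞) = (n : WithTop ℕ∞) + 1 := by norm_cast
    rw [this, contDiff_succ_iff_fderiv_apply]
    refine ⟨fun x => ?_, by simp, fun y => ?_⟩
    · obtain ⟨L, _, hL⟩ := rcCur_hasFDerivAt f hf x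
      exact hL.differentiableAt
    · convert ih _ (rcPartial_contDiff f hf y) using 1
      ext1 x
      obtain ⟨L, h1, hL⟩ := rcCur_hasFDerivAt f hf x
      rw [hL.fderiv, h1]

theorem rcCur_contDiff [FiniteDimensional ℝ E] (f : ℝ × E → ℝ) (hf : ContDiff ℝ (⊤ : ℕ∞) f) :
    ContDiff ℝ (⊤ : ℕ∞) (fun x => rcCur f hf.continuous x) :=
  contDiff_infty.2 fun n => rcCur_contDiff_nat n f hf

/-- extension of a function on the unit interval -/
noncomputable def rcExt (f : C(unitInterval, ℝ)) (t : ℝ) : ℝ :=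
  f (Set.projIcc (0 : ℝ) 1 zero_le_one t)

theorem rcExt_continuous (f : C(unitInterval, ℝ)) : Continuous (rcExt f) :=
  f.continuous.comp continuous_projIcc

theorem rcExt_coe (f : C(unitInterval, ℝ)) (s : unitInterval) : rcExt f s = f s := by
  simp [rcExt, Set.projIcc_val]

theorem rcExt_norm_le (f : C(unitInterval, ℝ)) (t : ℝ) : ‖rcExt f t‖ ≤ ‖f‖ :=
  f.norm_coe_le_norm _

theorem rcInt_continuous (g : ℝ → ℝ) (hg : Continuous g) :
    Continuous (fun s : ℝ => ∫ t in (0 : ℝ)..s, g t) :=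
  intervalIntegral.continuous_primitive (fun a b => hg.intervalIntegrable a b) 0

/-- Integration operator. -/
noncomputable def rcJ : C(unitInterval, ℝ) →L[ℝ] C(unitInterval, ℝ) :=
  LinearMap.mkContinuous
    { toFun := fun f => ⟨fun s => ∫ t in (0 : ℝ)..s, rcExt f t,
        (rcInt_continuous _ (rcExt_continuous f)).comp continuous_subtype_val⟩
      map_add' := by
        intro f g
        ext s
        exact intervalIntegral.integral_add ((rcExt_continuous f).intervalIntegrable _ _)
          ((rcExt_continuous g).intervalIntegrable _ _)
      map_smul' := by
        intro c f
        ext s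
        exact intervalIntegral.integral_const_mul c (rcExt f) }
    1 (by
      intro f
      rw [ContinuousMap.norm_le _ (by positivity)]
      intro s
      have := intervalIntegral.norm_integral_le_of_norm_le_const (a := 0) (b := (s : ℝ))
        (f := rcExt f) (C := ‖f‖) (fun t _ => rcExt_norm_le f t)
      have hs0 : 0 ≤ (s : ℝ) := s.2.1
      have hs1 : (s : ℝ) ≤ 1 := s.2.2
      rw [sub_zero, abs_of_nonneg hs0] at this
      refine this.trans ?_
      nlinarith [norm_nonneg f])

theorem rcJ_apply (f : C(unitInterval, ℝ)) (s : unitInterval) :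
    rcJ f s = ∫ t in (0 : ℝ)..s, rcExt f t := rfl

/-- Rescaling of the unit interval. -/
noncomputable def rcMulMap (l : unitInterval) : C(unitInterval, unitInterval) :=
  ⟨fun s => l * s, by fun_prop⟩

theorem rcJ_scale (f : C(unitInterval, ℝ)) (l : unitInterval) :
    (rcJ f).comp (rcMulMap l) = (l : ℝ) • rcJ (f.comp (rcMulMap l)) := by
  ext s
  change (∫ t in (0 : ℝ)..((l * s : unitInterval) : ℝ), rcExt f t)
    = (l : ℝ) • ∫ t in (0 : ℝ)..s, rcExt (f.comp (rcMulMap l)) t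
  have h := intervalIntegral.smul_integral_comp_mul_left (a := 0) (b := (s : ℝ))
    (rcExt f) (l : ℝ)
  rw [mul_zero] at h
  rw [show (((l * s : unitInterval)) : ℝ) = (l : ℝ) * s from rfl, ← h]
  congr 1
  apply intervalIntegral.integral_congr
  intro t ht
  rw [Set.uIcc_of_le s.2.1] at ht
  have ht' : t ∈ unitInterval := ⟨ht.1, ht.2.trans s.2.2⟩
  have h1 := rcExt_coe f (l * ⟨t, ht'⟩)
  have h2 := rcExt_coe (f.comp (rcMulMap l)) ⟨t, ht'⟩
  change rcExt f ((l : ℝ) * t) = _ at h1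
  simp only at h2
  simp only [h1, h2]
  rfl

/-- The Volterra operator. -/
noncomputable def rcK : C(unitInterval, ℝ) →L[ℝ] (C(unitInterval, ℝ) →L[ℝ] C(unitInterval, ℝ)) :=
  (ContinuousLinearMap.compL ℝ C(unitInterval, ℝ) C(unitInterval, ℝ) C(unitInterval, ℝ)
    (rcJ.comp rcJ)).comp (ContinuousLinearMap.mul ℝ C(unitInterval, ℝ))

theorem rcK_apply (q v : C(unitInterval, ℝ)) : rcK q v = rcJ (rcJ (q * v)) := rfl

/-- The coordinate. -/
noncomputable def rcId : C(unitInterval, ℝ) := ⟨fun s => (s : ℝ), continuous_subtype_val⟩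

/-- The solution. -/
noncomputable def rcV (q : E → C(unitInterval, ℝ)) (p : E →L[ℝ] ℝ) (x : E) : C(unitInterval, ℝ) :=
  Ring.inverse (1 + rcK (q x)) (1 + p x • rcId)

theorem rcV_eq (q : E → C(unitInterval, ℝ)) (p : E →L[ℝ] ℝ) (x : E) (hu : IsUnit (1 + rcK (q x))) :
    rcV q p x + rcJ (rcJ (q x * rcV q p x)) = 1 + p x • rcId := by
  have h := Ring.mul_inverse_cancel _ hu
  have h2 := congrArg (fun T : C(unitInterval, ℝ) →L[ℝ] C(unitInterval, ℝ) =>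
    T (1 + p x • rcId)) h
  simpa [rcV, rcK_apply] using h2

theorem rcV_unique (q : E → C(unitInterval, ℝ)) (p : E →L[ℝ] ℝ) (x : E)
    (hu : IsUnit (1 + rcK (q x))) (v : C(unitInterval, ℝ))
    (hv : v + rcJ (rcJ (q x * v)) = 1 + p x • rcId) : v = rcV q p x := by
  have h := Ring.inverse_mul_cancel _ hu
  have h2 := congrArg (fun T : C(unitInterval, ℝ) →L[ℝ] C(unitInterval, ℝ) => T v) h
  have h3 : (1 + rcK (q x)) v = 1 + p x • rcId := by
    simpa [rcK_apply] using hv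
  simp only [mul_apply_eq_comp, h3] at h2
  exact h2.symm

theorem rcAbs_contDiffAt {F : Type*} [NormedAddCommGroup F] [NormedSpace ℝ F] [CompleteSpace F]
    (K : F →L[ℝ] F →L[ℝ] F) (q b : E → F) (hq : ContDiff ℝ (⊤ : ℕ∞) q)
    (hb : ContDiff ℝ (⊤ : ℕ∞) b) (x : E) (hu : IsUnit (1 + K (q x))) :
    ContDiffAt ℝ (⊤ : ℕ∞) (fun x => Ring.inverse (1 + K (q x)) (b x)) x := by
  have h1 : ContDiff ℝ (⊤ : ℕ∞) (fun x => 1 + K (q x)) :=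
    contDiff_const.add (K.contDiff.comp hq)
  obtain ⟨u, hu⟩ := hu
  have h2 : ContDiffAt ℝ (⊤ : ℕ∞) Ring.inverse (1 + K (q x)) := by
    rw [← hu]; exact contDiffAt_ringInverse ℝ u
  have h3 : ContDiffAt ℝ (⊤ : ℕ∞) (fun x => Ring.inverse (1 + K (q x))) x :=
    ContDiffAt.comp (g := Ring.inverse) (f := fun x => 1 + K (q x)) x h2 h1.contDiffAt
  exact h3.clm_apply hb.contDiffAt

theorem rcAbs_unit {F : Type*} [NormedAddCommGroup F] [NormedSpace ℝ F] [CompleteSpace F]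
    (K : F →L[ℝ] F →L[ℝ] F) (q : E → F) (hq : Continuous q) (h0 : q 0 = 0) :
    ∀ᶠ x in 𝓝 (0 : E), IsUnit (1 + K (q x)) := by
  have h1 : Continuous (fun x => 1 + K (q x)) := by fun_prop
  have h2 : IsOpen {T : F →L[ℝ] F | IsUnit T} := Units.isOpen
  exact (h1.tendsto 0).eventually (h2.mem_nhds (by simp [h0]))

theorem rcV_contDiffAt (q : E → C(unitInterval, ℝ)) (hq : ContDiff ℝ (⊤ : ℕ∞) q)
    (p : E →L[ℝ] ℝ) (x : E) (hu : IsUnit (1 + rcK (q x))) :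
    ContDiffAt ℝ (⊤ : ℕ∞) (rcV q p) x := by
  have h4 : ContDiff ℝ (⊤ : ℕ∞) (fun x => (1 + p x • rcId : C(unitInterval, ℝ))) :=
    contDiff_const.add (p.contDiff.smul contDiff_const)
  exact rcAbs_contDiffAt rcK q _ hq h4 x hu

theorem rcV_unit (q : E → C(unitInterval, ℝ)) (hq : Continuous q) (h0 : q 0 = 0) :
    ∀ᶠ x in 𝓝 (0 : E), IsUnit (1 + rcK (q x)) := rcAbs_unit rcK q hq h0

theorem rcV_scale (q : E → C(unitInterval, ℝ)) (p : E →L[ℝ] ℝ) (x : E) (l : unitInterval)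
    (hq : q ((l : ℝ) • x) = ((l : ℝ) ^ 2) • (q x).comp (rcMulMap l))
    (hu : IsUnit (1 + rcK (q x))) (hu' : IsUnit (1 + rcK (q ((l : ℝ) • x)))) :
    (rcV q p x).comp (rcMulMap l) = rcV q p ((l : ℝ) • x) := by
  apply rcV_unique q p _ hu'
  have h := congrArg (fun f : C(unitInterval, ℝ) => f.comp (rcMulMap l)) (rcV_eq q p x hu)
  simp only [ContinuousMap.add_comp] at h
  rw [rcJ_scale, rcJ_scale, map_smul, smul_smul, ContinuousMap.mul_comp] at h
  rw [hq, smul_mul_assoc, map_smul, map_smul, pow_two, h]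
  ext s
  simp [rcMulMap, rcId]
  ring

theorem rcCore [FiniteDimensional ℝ E] (Q : ℝ × E → ℝ) (hQ : ContDiff ℝ (⊤ : ℕ∞) Q)
    (hs : ∀ (s l : ℝ) (x : E), Q (s, l • x) = l ^ 2 * Q (l * s, x)) (p : E →L[ℝ] ℝ) :
    ∃ δ > (0 : ℝ), ∃ V A : E → ℝ → ℝ,
      ContDiffOn ℝ (⊤ : ℕ∞) (fun x => V x 1) (Metric.ball 0 δ) ∧
      ContinuousOn (fun x => A x 1) (Metric.ball 0 δ) ∧
      (∀ x, V x 0 = 1) ∧ (∀ x, A x 0 = p x) ∧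
      (∀ x ∈ Metric.ball (0 : E) δ, ∀ s ∈ Set.Icc (0 : ℝ) 1, 0 < V x s) ∧
      (∀ x s, HasDerivAt (V x) (A x s) s) ∧
      (∀ x, Continuous (A x)) ∧
      (∀ x ∈ Metric.ball (0 : E) δ, ∀ s ∈ Set.Icc (0 : ℝ) 1,
        HasDerivAt (A x) (-(Q (s, x) * V x s)) s) ∧
      (∀ x ∈ Metric.ball (0 : E) δ, ∀ l ∈ Set.Icc (0 : ℝ) 1,
        V (l • x) 1 = V x l ∧ A (l • x) 1 = l * A x l) := by
  set q : E → C(unitInterval, ℝ) := fun x => rcCur Q hQ.continuous x with hqdef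
  have hqs : ContDiff ℝ (⊤ : ℕ∞) q := rcCur_contDiff Q hQ
  have hqsc : ∀ (x : E) (l : unitInterval),
      q ((l : ℝ) • x) = ((l : ℝ) ^ 2) • (q x).comp (rcMulMap l) := by
    intro x l
    ext s
    exact hs s l x
  have hq0 : q 0 = 0 := by
    have := hqsc 0 0
    simpa using this
  have hunit := rcV_unit q hqs.continuous hq0
  have hV0 : rcV q p 0 = 1 := by
    have h0 : IsUnit (1 + rcK (q 0)) := hunit.self_of_nhds
    symm
    apply rcV_unique q p 0 h0
    simp [hq0]
  have hnear : ∀ᶠ x in 𝓝 (0 : E), dist (rcV q p x) 1 < 1 := by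
    have hc : ContinuousAt (rcV q p) 0 :=
      (rcV_contDiffAt q hqs p 0 hunit.self_of_nhds).continuousAt
    have := Metric.tendsto_nhds.1 hc.tendsto 1 one_pos
    rwa [hV0] at this
  obtain ⟨δ, hδ, hball⟩ := Metric.eventually_nhds_iff_ball.1 (hunit.and hnear)
  let g : E → C(unitInterval, ℝ) := fun x => q x * rcV q p x
  let A : E → ℝ → ℝ := fun x s => p x - ∫ t in (0 : ℝ)..s, rcExt (g x) t
  have hA : ∀ x s, HasDerivAt (A x) (-(rcExt (g x) s)) s := by
    intro x s
    have := ((rcExt_continuous (g x)).integral_hasStrictDerivAt 0 s).hasDerivAt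
    simpa using this.const_sub (p x)
  have hAc : ∀ x, Continuous (A x) := fun x =>
    continuous_iff_continuousAt.2 fun s => (hA x s).continuousAt
  let V : E → ℝ → ℝ := fun x s => 1 + ∫ t in (0 : ℝ)..s, A x t
  have hV : ∀ x s, HasDerivAt (V x) (A x s) s := by
    intro x s
    have := ((hAc x).integral_hasStrictDerivAt 0 s).hasDerivAt
    exact this.const_add 1
  have hAJ : ∀ x (s : unitInterval), A x s = p x - rcJ (g x) s := fun x s => rfl
  have hVv : ∀ x ∈ Metric.ball (0 : E) δ, ∀ s : unitInterval, V x s = rcV q p x s := by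
    intro x hx s
    have he := congrArg (fun f : C(unitInterval, ℝ) => f s) (rcV_eq q p x (hball x hx).1)
    have h1 : (∫ t in (0 : ℝ)..s, A x t) = ∫ t in (0 : ℝ)..s, (p x - rcExt (rcJ (g x)) t) := by
      apply intervalIntegral.integral_congr
      intro t ht
      rw [Set.uIcc_of_le s.2.1] at ht
      have ht' : t ∈ unitInterval := ⟨ht.1, ht.2.trans s.2.2⟩
      have h2 := rcExt_coe (rcJ (g x)) ⟨t, ht'⟩
      have h3 := hAJ x ⟨t, ht'⟩
      simp only at h2 h3
      simp only [h2, h3]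
    have h4 : V x s = 1 + ∫ t in (0 : ℝ)..s, A x t := rfl
    rw [h4, h1, intervalIntegral.integral_sub (by simp)
      ((rcExt_continuous _).intervalIntegrable _ _), ← rcJ_apply]
    simp only [ContinuousMap.add_apply, ContinuousMap.smul_apply, ContinuousMap.one_apply] at he
    have h5 : rcId s = (s : ℝ) := rfl
    rw [h5] at he
    simp only [intervalIntegral.integral_const, sub_zero, smul_eq_mul] at he ⊢
    linarith
  have hscale : ∀ x ∈ Metric.ball (0 : E) δ, ∀ l : unitInterval,
      (l : ℝ) • x ∈ Metric.ball (0 : E) δ := by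
    intro x hx l
    rw [mem_ball_zero_iff] at hx ⊢
    rw [norm_smul, Real.norm_of_nonneg l.2.1]
    exact (mul_le_of_le_one_left (norm_nonneg _) l.2.2).trans_lt hx
  have hgs : ∀ x ∈ Metric.ball (0 : E) δ, ∀ l : unitInterval,
      (rcV q p x).comp (rcMulMap l) = rcV q p ((l : ℝ) • x) := fun x hx l =>
    rcV_scale q p x l (hqsc x l) (hball x hx).1 (hball _ (hscale x hx l)).1
  refine ⟨δ, hδ, V, A, ?_, ?_, ?_, ?_, ?_, hV, hAc, ?_, ?_⟩
  · have h1 : ContDiffOn ℝ (⊤ : ℕ∞) (fun x => rcV q p x 1) (Metric.ball 0 δ) := by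
      intro x hx
      have h2 := rcV_contDiffAt q hqs p x (hball x hx).1
      exact ((ContinuousMap.evalCLM ℝ (1 : unitInterval)).contDiff.contDiffAt.comp x
        h2).contDiffWithinAt
    refine h1.congr fun x hx => ?_
    exact hVv x hx 1
  · have h1 : ContinuousOn (fun x => p x - rcJ (g x) 1) (Metric.ball 0 δ) := by
      intro x hx
      have h2 := (rcV_contDiffAt q hqs p x (hball x hx).1).continuousAt
      have h3 : ContinuousAt g x := hqs.continuous.continuousAt.mul h2
      have h4 : ContinuousAt (fun x => rcJ (g x) 1) x :=
        ((ContinuousMap.evalCLM ℝ (1 : unitInterval)).continuous.comp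
          rcJ.continuous).continuousAt.comp h3
      exact (p.continuous.continuousAt.sub h4).continuousWithinAt
    exact h1.congr fun x hx => hAJ x 1
  · intro x; simp [V]
  · intro x; simp [A]
  · intro x hx s hs
    rw [show V x s = rcV q p x ⟨s, hs⟩ from hVv x hx ⟨s, hs⟩]
    have h1 := (ContinuousMap.dist_apply_le_dist (f := rcV q p x) (g := 1)
      (⟨s, hs⟩ : unitInterval)).trans_lt (hball x hx).2
    rw [Real.dist_eq, ContinuousMap.one_apply, abs_lt] at h1
    linarith [h1.1]
  · intro x hx s hs
    have h1 := hA x s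
    have h2 : rcExt (g x) s = Q (s, x) * V x s := by
      rw [show V x s = rcV q p x ⟨s, hs⟩ from hVv x hx ⟨s, hs⟩]
      exact rcExt_coe (g x) ⟨s, hs⟩
    rwa [h2] at h1
  · intro x hx l hl
    have h1 := hgs x hx ⟨l, hl⟩
    have h1m : (rcMulMap ⟨l, hl⟩) 1 = (⟨l, hl⟩ : unitInterval) := mul_one _
    constructor
    · have h2 := congrArg (fun f : C(unitInterval, ℝ) => f 1) h1
      have h3 := hVv _ (hscale x hx ⟨l, hl⟩) 1
      have h4 := hVv x hx ⟨l, hl⟩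
      simp only [ContinuousMap.comp_apply, h1m] at h2
      exact h3.trans (h2.symm.trans h4.symm)
    · have h5 : g (l • x) = (l ^ 2) • (g x).comp (rcMulMap ⟨l, hl⟩) := by
        have h6 := hqsc x ⟨l, hl⟩
        simp only at h6 h1
        simp only [g]
        rw [h6, ← h1, ContinuousMap.mul_comp, smul_mul_assoc]
      have h7 := hAJ (l • x) 1
      have h8 := hAJ x ⟨l, hl⟩
      have h9 := congrArg (fun f : C(unitInterval, ℝ) => f 1) (rcJ_scale (g x) ⟨l, hl⟩)
      simp only [ContinuousMap.comp_apply, h1m, ContinuousMap.smul_apply, smul_eq_mul] at h9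
      rw [h5, map_smul] at h7
      simp only [ContinuousMap.smul_apply, smul_eq_mul, map_smul] at h7 h8
      rw [h9] at h8
      rw [h8]
      refine h7.trans ?_
      ring

end core

theorem rcCutoff {E : Type*} [NormedAddCommGroup E] [NormedSpace ℝ E] [HasContDiffBump E]
    (f : E → ℝ) (ε : ℝ) (hε : 0 < ε) (hf : ContDiffOn ℝ (⊤ : ℕ∞) f (Metric.ball 0 ε)) :
    ∃ F : E → ℝ, ContDiff ℝ (⊤ : ℕ∞) F ∧ ∀ x ∈ Metric.ball (0 : E) (ε / 2), F x = f x := by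
  let χ : ContDiffBump (0 : E) := ⟨ε / 2, 3 * ε / 4, by linarith, by linarith⟩
  refine ⟨fun x => χ x * f x, ?_, ?_⟩
  · rw [contDiff_iff_contDiffAt]
    intro x
    by_cases h1 : x ∈ tsupport χ
    swap
    · have h2 := notMem_tsupport_iff_eventuallyEq.1 h1
      refine (contDiffAt_const (c := (0 : ℝ))).congr_of_eventuallyEq ?_
      filter_upwards [h2] with z hz
      simp [hz]
    rw [χ.tsupport_eq, mem_closedBall_zero_iff] at h1
    have h2 : x ∈ Metric.ball (0 : E) ε := by
      rw [mem_ball_zero_iff]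
      have : χ.rOut = 3 * ε / 4 := rfl
      linarith
    exact χ.contDiff.contDiffAt.mul (hf.contDiffAt (Metric.isOpen_ball.mem_nhds h2))
  · intro x hx
    have : χ x = 1 := χ.one_of_mem_closedBall (Metric.ball_subset_closedBall hx)
    simp [this]

theorem rcUpdateCont (f : ℝ → ℝ) (r L : ℝ)
    (hf : ∀ t ∈ Set.Ioc 0 r, ContinuousAt f t)
    (hL : Tendsto f (𝓝[>] 0) (𝓝 L)) : ContinuousOn (Function.update f 0 L) (Set.Icc 0 r) := by
  intro t ht
  rcases eq_or_lt_of_le ht.1 with h | h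
  · subst h
    rw [continuousWithinAt_update_same]
    refine hL.mono_left (nhdsWithin_mono _ ?_)
    intro z hz
    exact lt_of_le_of_ne hz.1.1 (fun h => hz.2 h.symm)
  · have h1 : ContinuousAt (Function.update f 0 L) t := by
      rw [continuousAt_update_of_ne h.ne']
      exact hf t ⟨h, ht.2⟩
    exact h1.continuousWithinAt

theorem rcUnique (f g k : ℝ → ℝ) (δ L : ℝ)
    (hf : ∀ r ∈ Set.Ioo 0 δ, HasDerivAt f (f r ^ 2 + k r) r)
    (hg : ∀ r ∈ Set.Ioo 0 δ, HasDerivAt g (g r ^ 2 + k r) r)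
    (hfL : Tendsto f (𝓝[>] 0) (𝓝 L)) (hgL : Tendsto g (𝓝[>] 0) (𝓝 L)) :
    ∀ r ∈ Set.Ioo 0 δ, f r = g r := by
  intro r hr
  have hFc := rcUpdateCont f r L
    (fun t ht => (hf t ⟨ht.1, ht.2.trans_lt hr.2⟩).continuousAt) hfL
  have hGc := rcUpdateCont g r L
    (fun t ht => (hg t ⟨ht.1, ht.2.trans_lt hr.2⟩).continuousAt) hgL
  set F := Function.update f 0 L with hF
  set G := Function.update g 0 L with hG
  have hFf : ∀ t, 0 < t → F t = f t := fun t ht => Function.update_of_ne ht.ne' _ _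
  have hGg : ∀ t, 0 < t → G t = g t := fun t ht => Function.update_of_ne ht.ne' _ _
  obtain ⟨M, hM⟩ := (isCompact_Icc (a := (0 : ℝ)) (b := r)).exists_bound_of_continuousOn
    (hFc.add hGc)
  have hd : ∀ t ∈ Set.Ioo 0 r, HasDerivAt (fun t => (F t - G t) ^ 2 * Real.exp (-(2 * M) * t))
      (2 * (f t - g t) ^ 2 * (f t + g t - M) * Real.exp (-(2 * M) * t)) t := by
    intro t ht
    have ht' : t ∈ Set.Ioo 0 δ := ⟨ht.1, ht.2.trans hr.2⟩
    have h1 : HasDerivAt (fun t => (f t - g t) ^ 2 * Real.exp (-(2 * M) * t))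
      (2 * (f t - g t) ^ 2 * (f t + g t - M) * Real.exp (-(2 * M) * t)) t := by
      have h2 := (((hf t ht').sub (hg t ht')).pow 2).mul
        (((hasDerivAt_id t).const_mul (-(2 * M))).exp)
      refine h2.congr_deriv ?_
      simp
      ring
    refine h1.congr_of_eventuallyEq ?_
    filter_upwards [lt_mem_nhds ht.1] with z hz
    rw [hFf z hz, hGg z hz]
  have hanti : AntitoneOn (fun t => (F t - G t) ^ 2 * Real.exp (-(2 * M) * t)) (Set.Icc 0 r) := by
    apply antitoneOn_of_deriv_nonpos (convex_Icc 0 r)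
    · exact ((hFc.sub hGc).pow 2).mul (by fun_prop)
    · rw [interior_Icc]
      intro t ht
      exact (hd t ht).differentiableAt.differentiableWithinAt
    · rw [interior_Icc]
      intro t ht
      rw [(hd t ht).deriv]
      have h1 := hM t ⟨ht.1.le, ht.2.le⟩
      simp only [Pi.add_apply, hFf t ht.1, hGg t ht.1] at h1
      have h2 := (le_abs_self _).trans h1
      have h3 : 0 ≤ 2 * (f t - g t) ^ 2 := by positivity
      exact mul_nonpos_of_nonpos_of_nonneg
        (mul_nonpos_of_nonneg_of_nonpos h3 (by linarith)) (Real.exp_pos _).le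
  have h := hanti (Set.left_mem_Icc.2 hr.1.le) (Set.right_mem_Icc.2 hr.1.le) hr.1.le
  have hF0 : F 0 = L := Function.update_self _ _ _
  have hG0 : G 0 = L := Function.update_self _ _ _
  simp only [hF0, hG0, hFf r hr.1, hGg r hr.1, sub_self] at h
  have h3 : (f r - g r) ^ 2 ≤ 0 := by
    by_contra hcon
    have := mul_pos (not_le.1 hcon) (Real.exp_pos (-(2 * M) * r))
    simp only [ne_eq, OfNat.ofNat_ne_zero, not_false_eq_true, zero_pow, zero_mul] at h
    linarith
  have h4 : f r - g r = 0 := by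
    have := le_antisymm h3 (sq_nonneg _)
    exact pow_eq_zero_iff (two_ne_zero) |>.1 this
  linarith

theorem riccati_cone_smooth_solution
    (a : ℝ × EuclideanSpace ℝ (Fin 3) → ℝ)
    (b : Fin 3 → ℝ × EuclideanSpace ℝ (Fin 3) → ℝ)
    (c : Fin 3 → Fin 3 → ℝ × EuclideanSpace ℝ (Fin 3) → ℝ)
    (ε₀ : ℝ) (hε₀ : 0 < ε₀)
    (ha : ContDiffOn ℝ (⊤ : ℕ∞) a (Metric.ball (0 : ℝ × EuclideanSpace ℝ (Fin 3)) ε₀))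
    (hb : ∀ i, ContDiffOn ℝ (⊤ : ℕ∞) (b i)
      (Metric.ball (0 : ℝ × EuclideanSpace ℝ (Fin 3)) ε₀))
    (hc : ∀ i j, ContDiffOn ℝ (⊤ : ℕ∞) (c i j)
      (Metric.ball (0 : ℝ × EuclideanSpace ℝ (Fin 3)) ε₀))
    (α : ℝ) (hα : 0 < α) (β : Fin 4 → ℝ) :
    ∃ δ > (0 : ℝ), δ ≤ ε₀ ∧ ∃ φ : EuclideanSpace ℝ (Fin 3) → ℝ,
      ContinuousOn φ {y : EuclideanSpace ℝ (Fin 3) | y ≠ 0 ∧ ‖y‖ < δ} ∧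
      (∀ Θ : EuclideanSpace ℝ (Fin 3), ‖Θ‖ = 1 →
        (∀ r ∈ Set.Ioo (0 : ℝ) δ,
          HasDerivAt (fun t : ℝ => φ (t • Θ))
            ((φ (r • Θ)) ^ 2 + (1 / 2) * coneSource a b c (r • Θ)) r) ∧
        Tendsto (fun r : ℝ => φ (r • Θ)) (𝓝[>] (0 : ℝ))
          (𝓝 (α⁻¹ * (β 0 + ∑ i : Fin 3, β i.succ * Θ i)))) ∧
      (∀ φ' : EuclideanSpace ℝ (Fin 3) → ℝ,
        ContinuousOn φ' {y : EuclideanSpace ℝ (Fin 3) | y ≠ 0 ∧ ‖y‖ < δ} →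
        (∀ Θ : EuclideanSpace ℝ (Fin 3), ‖Θ‖ = 1 →
          (∀ r ∈ Set.Ioo (0 : ℝ) δ,
            HasDerivAt (fun t : ℝ => φ' (t • Θ))
              ((φ' (r • Θ)) ^ 2 + (1 / 2) * coneSource a b c (r • Θ)) r) ∧
          Tendsto (fun r : ℝ => φ' (r • Θ)) (𝓝[>] (0 : ℝ))
            (𝓝 (α⁻¹ * (β 0 + ∑ i : Fin 3, β i.succ * Θ i)))) →
        Set.EqOn φ' φ {y : EuclideanSpace ℝ (Fin 3) | y ≠ 0 ∧ ‖y‖ < δ}) ∧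
      (∀ Θ : EuclideanSpace ℝ (Fin 3), ‖Θ‖ = 1 → ∀ r ∈ Set.Ioo (0 : ℝ) δ,
        IntervalIntegrable (fun s : ℝ => φ (s • Θ)) volume 0 r) ∧
      ∃ (θ : ℝ × EuclideanSpace ℝ (Fin 3) → ℝ) (ε : ℝ), 0 < ε ∧
        ContDiffOn ℝ (⊤ : ℕ∞) θ (Metric.ball (0 : ℝ × EuclideanSpace ℝ (Fin 3)) ε) ∧
        θ (0, 0) = α ∧
        ∀ y : EuclideanSpace ℝ (Fin 3), y ≠ 0 → ‖y‖ < ε →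
          θ (‖y‖, y) = α * Real.exp (∫ s in (0 : ℝ)..‖y‖, φ (s • (‖y‖⁻¹ • y))) := by
  choose! at' hat' using fun (f : ℝ × EuclideanSpace ℝ (Fin 3) → ℝ)
    (hf : ContDiffOn ℝ (⊤ : ℕ∞) f (Metric.ball 0 ε₀)) => rcCutoff f ε₀ hε₀ hf
  set a' := at' a with ha'
  set b' := fun i => at' (b i) with hb'
  set c' := fun i j => at' (c i j) with hc'
  have ha1 : ContDiff ℝ (⊤ : ℕ∞) a' := (hat' a ha).1
  have hb1 : ∀ i, ContDiff ℝ (⊤ : ℕ∞) (b' i) := fun i => (hat' _ (hb i)).1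
  have hc1 : ∀ i j, ContDiff ℝ (⊤ : ℕ∞) (c' i j) := fun i j => (hat' _ (hc i j)).1
  have ha2 := (hat' a ha).2
  have hb2 := fun i => (hat' _ (hb i)).2
  have hc2 := fun i j => (hat' _ (hc i j)).2
  let Q : ℝ × (ℝ × EuclideanSpace ℝ (Fin 3)) → ℝ := fun z =>
    (1 / 2) * (z.2.1 ^ 2 * a' (z.1 • z.2) + 2 * ∑ i, b' i (z.1 • z.2) * (z.2.1 * z.2.2 i)
      + ∑ i, ∑ j, c' i j (z.1 • z.2) * z.2.2 i * z.2.2 j)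
  have hQ : ContDiff ℝ (⊤ : ℕ∞) Q := by
    have hsm : ContDiff ℝ (⊤ : ℕ∞) (fun z : ℝ × (ℝ × EuclideanSpace ℝ (Fin 3)) => z.1 • z.2) :=
      contDiff_fst.smul contDiff_snd
    have hco : ∀ i, ContDiff ℝ (⊤ : ℕ∞)
        (fun z : ℝ × (ℝ × EuclideanSpace ℝ (Fin 3)) => z.2.2 i) := by
      intro i
      exact (EuclideanSpace.proj (𝕜 := ℝ) i).contDiff.comp (contDiff_snd.comp contDiff_snd)
    have ht : ContDiff ℝ (⊤ : ℕ∞)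
        (fun z : ℝ × (ℝ × EuclideanSpace ℝ (Fin 3)) => z.2.1) :=
      contDiff_fst.comp contDiff_snd
    refine contDiff_const.mul ((((ht.pow 2).mul (ha1.comp hsm)).add
      (contDiff_const.mul (ContDiff.sum fun i _ => ?_))).add
      (ContDiff.sum fun i _ => ContDiff.sum fun j _ => ?_))
    · exact ((hb1 i).comp hsm).mul (ht.mul (hco i))
    · exact (((hc1 i j).comp hsm).mul (hco i)).mul (hco j)
  have hQs : ∀ (s l : ℝ) (x : ℝ × EuclideanSpace ℝ (Fin 3)),
      Q (s, l • x) = l ^ 2 * Q (l * s, x) := by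
    intro s l x
    have h1 : s • l • x = (l * s) • x := by rw [smul_smul, mul_comm]
    simp only [Q, h1, Prod.smul_fst, Prod.smul_snd, PiLp.smul_apply, smul_eq_mul,
      Fin.sum_univ_three]
    ring
  let p : ℝ × EuclideanSpace ℝ (Fin 3) →L[ℝ] ℝ :=
    (-α⁻¹) • (β 0 • ContinuousLinearMap.fst ℝ ℝ (EuclideanSpace ℝ (Fin 3)) +
      ∑ i : Fin 3, β i.succ • (EuclideanSpace.proj (𝕜 := ℝ) i).comp
        (ContinuousLinearMap.snd ℝ ℝ (EuclideanSpace ℝ (Fin 3))))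
  have hp : ∀ Θ, p (1, Θ) = -(α⁻¹ * (β 0 + ∑ i : Fin 3, β i.succ * Θ i)) := by
    intro Θ
    simp [p, Fin.sum_univ_three]
    ring
  obtain ⟨δ₁, hδ₁, V, A, hVs, hAc, hV0, hA0, hVpos, hVd, hAcont, hAd, hscale⟩ :=
    rcCore Q hQ hQs p
  set δ := min δ₁ (ε₀ / 2) with hδdef
  have hδ : 0 < δ := lt_min hδ₁ (by linarith)
  have hδ1 : δ ≤ δ₁ := min_le_left _ _
  have hδ2 : δ ≤ ε₀ / 2 := min_le_right _ _
  let φ : EuclideanSpace ℝ (Fin 3) → ℝ := fun y => -(A (‖y‖, y) 1) / (‖y‖ * V (‖y‖, y) 1)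
  have hnorm : ∀ y : EuclideanSpace ℝ (Fin 3), ‖((‖y‖, y) : ℝ × EuclideanSpace ℝ (Fin 3))‖ = ‖y‖ := by
    intro y; simp [Prod.norm_def]
  have hmem : ∀ (Θ : EuclideanSpace ℝ (Fin 3)), ‖Θ‖ = 1 → ∀ T ∈ Set.Ioo 0 δ,
      T • ((1, Θ) : ℝ × EuclideanSpace ℝ (Fin 3)) ∈ Metric.ball 0 δ₁ := by
    intro Θ hΘ T hT
    rw [mem_ball_zero_iff, norm_smul, Prod.norm_def, hΘ, Real.norm_of_nonneg hT.1.le]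
    simpa using hT.2.trans_le hδ1
  -- the solution along a ray
  let ψ : EuclideanSpace ℝ (Fin 3) → ℝ → ℝ → ℝ := fun Θ T t =>
    -(A (T • (1, Θ)) (t / T)) / (T * V (T • (1, Θ)) (t / T))
  have hunitmem : ∀ T t : ℝ, 0 < T → 0 ≤ t → t ≤ T → t / T ∈ Set.Icc (0 : ℝ) 1 := by
    intro T t hT ht htT
    exact ⟨by positivity, (div_le_one hT).2 htT⟩
  have hφψ : ∀ (Θ : EuclideanSpace ℝ (Fin 3)), ‖Θ‖ = 1 → ∀ T ∈ Set.Ioo 0 δ,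
      ∀ t ∈ Set.Ioc 0 T, φ (t • Θ) = ψ Θ T t := by
    intro Θ hΘ T hT t ht
    have hn : ‖t • Θ‖ = t := by rw [norm_smul, hΘ, Real.norm_of_nonneg ht.1.le, mul_one]
    have hx : ((t, t • Θ) : ℝ × EuclideanSpace ℝ (Fin 3)) = (t / T) • T • (1, Θ) := by
      rw [smul_smul, div_mul_cancel₀ _ hT.1.ne']
      simp
    obtain ⟨h1, h2⟩ := hscale _ (hmem Θ hΘ T hT) (t / T) (hunitmem T t hT.1 ht.1.le ht.2)
    have hv := hVpos _ (hmem Θ hΘ T hT) (t / T) (hunitmem T t hT.1 ht.1.le ht.2)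
    simp only [φ, ψ, hn]
    rw [hx, h1, h2]
    have := hT.1.ne'
    have := ht.1.ne'
    field_simp
  have hVcomp : ∀ (Θ : EuclideanSpace ℝ (Fin 3)) (T t : ℝ), HasDerivAt
      (fun t => V (T • (1, Θ)) (t / T)) (A (T • (1, Θ)) (t / T) * (1 / T)) t := by
    intro Θ T t
    exact (hVd (T • (1, Θ)) (t / T)).comp t ((hasDerivAt_id t).div_const T)
  have hψc : ∀ (Θ : EuclideanSpace ℝ (Fin 3)), ‖Θ‖ = 1 → ∀ T ∈ Set.Ioo 0 δ,
      ∀ t ∈ Set.Icc 0 T, ContinuousAt (ψ Θ T) t := by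
    intro Θ hΘ T hT t ht
    have hv := hVpos _ (hmem Θ hΘ T hT) (t / T) (hunitmem T t hT.1 ht.1 ht.2)
    have h1 : Continuous (fun t => A (T • (1, Θ)) (t / T)) :=
      (hAcont _).comp (continuous_id.div_const T)
    exact h1.continuousAt.neg.div (continuousAt_const.mul (hVcomp Θ T t).continuousAt)
      (mul_pos hT.1 hv).ne'
  have hsource : ∀ (Θ : EuclideanSpace ℝ (Fin 3)), ‖Θ‖ = 1 → ∀ T ∈ Set.Ioo 0 δ,
      ∀ r ∈ Set.Ioo 0 δ, Q (r / T, T • (1, Θ)) = T ^ 2 * ((1 / 2) * coneSource a b c (r • Θ)) := by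
    intro Θ hΘ T hT r hr
    have hn : ‖r • Θ‖ = r := by rw [norm_smul, hΘ, Real.norm_of_nonneg hr.1.le, mul_one]
    have hin : ((r, r • Θ) : ℝ × EuclideanSpace ℝ (Fin 3)) ∈ Metric.ball 0 (ε₀ / 2) := by
      have := hnorm (r • Θ)
      rw [hn] at this
      rw [mem_ball_zero_iff, this]
      exact hr.2.trans_le hδ2
    have hx : r • ((1, Θ) : ℝ × EuclideanSpace ℝ (Fin 3)) = (r, r • Θ) := by simp
    have hco : ∀ i, (r • Θ) i / r = Θ i := by
      intro i
      have := hr.1.ne'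
      simp only [PiLp.smul_apply, smul_eq_mul]
      field_simp
    rw [hQs, mul_div_cancel₀ _ hT.1.ne']
    simp only [Q, coneSource, hn, hco, hx, ha', hb', hc']
    simp only [ha2 _ hin, hb2 _ _ hin, hc2 _ _ _ hin, one_pow, one_mul]
  have hode : ∀ Θ : EuclideanSpace ℝ (Fin 3), ‖Θ‖ = 1 →
        (∀ r ∈ Set.Ioo (0 : ℝ) δ,
          HasDerivAt (fun t : ℝ => φ (t • Θ))
            ((φ (r • Θ)) ^ 2 + (1 / 2) * coneSource a b c (r • Θ)) r) ∧
        Tendsto (fun r : ℝ => φ (r • Θ)) (𝓝[>] (0 : ℝ))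
          (𝓝 (α⁻¹ * (β 0 + ∑ i : Fin 3, β i.succ * Θ i))) := by
    intro Θ hΘ
    constructor
    · intro r hr
      obtain ⟨T, hrT, hTδ⟩ := exists_between hr.2
      have hT : T ∈ Set.Ioo 0 δ := ⟨hr.1.trans hrT, hTδ⟩
      have hev : (fun t : ℝ => φ (t • Θ)) =ᶠ[𝓝 r] ψ Θ T := by
        filter_upwards [Ioo_mem_nhds hr.1 hrT] with t ht
        exact hφψ Θ hΘ T hT t ⟨ht.1, ht.2.le⟩
      refine HasDerivAt.congr_of_eventuallyEq ?_ hev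
      have hI := hunitmem T r hT.1 hr.1.le hrT.le
      have hv := hVpos _ (hmem Θ hΘ T hT) (r / T) hI
      have hAcomp : HasDerivAt (fun t => A (T • (1, Θ)) (t / T)) _ r :=
        (hAd _ (hmem Θ hΘ T hT) (r / T) hI).comp r ((hasDerivAt_id r).div_const T)
      have h1 := hAcomp.neg.div ((hVcomp Θ T r).const_mul T) (mul_pos hT.1 hv).ne'
      rw [hφψ Θ hΘ T hT r ⟨hr.1, hrT.le⟩]
      refine h1.congr_deriv ?_
      rw [hsource Θ hΘ T hT r hr]
      have hT0 := hT.1.ne'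
      simp only [ψ]
      simp only [Pi.neg_apply]
      field_simp
      ring
    · have hT : δ / 2 ∈ Set.Ioo 0 δ := ⟨by linarith, by linarith⟩
      have h1 := (hψc Θ hΘ _ hT 0 ⟨le_rfl, hT.1.le⟩).tendsto
      have h2 : ψ Θ (δ / 2) 0 = α⁻¹ * (β 0 + ∑ i : Fin 3, β i.succ * Θ i) := by
        simp only [ψ, zero_div, hA0, hV0, map_smul, hp, smul_eq_mul]
        have := hT.1.ne'
        field_simp
      rw [h2] at h1
      refine (h1.mono_left nhdsWithin_le_nhds).congr' ?_
      filter_upwards [Ioc_mem_nhdsGT hT.1] with t ht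
      exact (hφψ Θ hΘ _ hT t ht).symm
  have hint : ∀ (Θ : EuclideanSpace ℝ (Fin 3)), ‖Θ‖ = 1 → ∀ r ∈ Set.Ioo 0 δ,
      ContinuousOn (ψ Θ r) (Set.uIcc 0 r) := by
    intro Θ hΘ r hr t ht
    rw [Set.uIcc_of_le hr.1.le] at ht
    exact (hψc Θ hΘ r hr t ht).continuousWithinAt
  refine ⟨δ, hδ, by linarith, φ, ?_, hode, ?_, ?_, fun x => α / V x 1, δ, hδ, ?_, ?_, ?_⟩
  · have hmaps : Set.MapsTo (fun y : EuclideanSpace ℝ (Fin 3) => (‖y‖, y))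
        {y : EuclideanSpace ℝ (Fin 3) | y ≠ 0 ∧ ‖y‖ < δ} (Metric.ball 0 δ₁) := by
      intro y hy
      rw [mem_ball_zero_iff, hnorm]
      exact hy.2.trans_le hδ1
    have hc0 : Continuous (fun y : EuclideanSpace ℝ (Fin 3) => (‖y‖, y)) := by fun_prop
    have h1 := hAc.comp hc0.continuousOn hmaps
    have h2 := hVs.continuousOn.comp hc0.continuousOn hmaps
    refine h1.neg.div (continuous_norm.continuousOn.mul h2) ?_
    intro y hy
    exact (mul_pos (norm_pos_iff.2 hy.1) (hVpos _ (hmaps hy) 1 ⟨zero_le_one, le_rfl⟩)).ne'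
  · intro φ' _ hφ' y hy
    have hny : 0 < ‖y‖ := norm_pos_iff.2 hy.1
    have hΘ : ‖‖y‖⁻¹ • y‖ = 1 := by
      rw [norm_smul, norm_inv, norm_norm, inv_mul_cancel₀ hny.ne']
    have h := rcUnique (fun t => φ' (t • (‖y‖⁻¹ • y))) (fun t => φ (t • (‖y‖⁻¹ • y)))
      (fun t => (1 / 2) * coneSource a b c (t • (‖y‖⁻¹ • y))) δ _
      (hφ' _ hΘ).1 (hode _ hΘ).1 (hφ' _ hΘ).2 (hode _ hΘ).2 ‖y‖ ⟨hny, hy.2⟩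
    simpa [smul_smul, mul_inv_cancel₀ hny.ne'] using h
  · intro Θ hΘ r hr
    refine (hint Θ hΘ r hr).intervalIntegrable.congr ?_
    intro t ht
    rw [Set.uIoc_of_le hr.1.le] at ht
    exact (hφψ Θ hΘ r hr t ht).symm
  · have h1 : ContDiffOn ℝ (⊤ : ℕ∞) (fun x => V x 1) (Metric.ball 0 δ) :=
      hVs.mono (Metric.ball_subset_ball hδ1)
    refine contDiffOn_const.div h1 ?_
    intro x hx
    exact (hVpos x (Metric.ball_subset_ball hδ1 hx) 1 ⟨zero_le_one, le_rfl⟩).ne'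
  · have h1 := (hscale 0 (Metric.mem_ball_self hδ₁) 0 ⟨le_rfl, zero_le_one⟩).1
    rw [hV0, smul_zero] at h1
    change α / V 0 1 = α
    rw [h1, div_one]
  · intro y hy hyδ
    have hny : 0 < ‖y‖ := norm_pos_iff.2 hy
    have hΘ : ‖‖y‖⁻¹ • y‖ = 1 := by
      rw [norm_smul, norm_inv, norm_norm, inv_mul_cancel₀ hny.ne']
    have hr : ‖y‖ ∈ Set.Ioo 0 δ := ⟨hny, hyδ⟩
    set Θ := ‖y‖⁻¹ • y with hΘdef
    set r := ‖y‖ with hrdef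
    have hx : ((r, y) : ℝ × EuclideanSpace ℝ (Fin 3)) = r • (1, Θ) := by
      simp [hΘdef, smul_smul, mul_inv_cancel₀ hny.ne']
    have hI : (∫ s in (0 : ℝ)..r, φ (s • Θ)) = ∫ s in (0 : ℝ)..r, ψ Θ r s := by
      apply intervalIntegral.integral_congr_ae
      refine Eventually.of_forall fun t ht => ?_
      rw [Set.uIoc_of_le hny.le] at ht
      exact hφψ Θ hΘ r hr t ht
    have hF : (∫ s in (0 : ℝ)..r, ψ Θ r s) =
        -Real.log (V (r • (1, Θ)) (r / r)) - -Real.log (V (r • (1, Θ)) (0 / r)) := by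
      refine intervalIntegral.integral_eq_sub_of_hasDerivAt
        (f := fun t => -Real.log (V (r • (1, Θ)) (t / r))) ?_
        (hint Θ hΘ r hr).intervalIntegrable
      intro t ht
      rw [Set.uIcc_of_le hny.le] at ht
      have hv := hVpos _ (hmem Θ hΘ r hr) (t / r) (hunitmem r t hny ht.1 ht.2)
      refine ((hVcomp Θ r t).log hv.ne').neg.congr_deriv ?_
      simp only [ψ]
      field_simp
    have hv := hVpos _ (hmem Θ hΘ r hr) 1 ⟨zero_le_one, le_rfl⟩
    rw [hI, hF, zero_div, hV0, div_self hny.ne', Real.log_one, neg_zero, sub_zero, Real.exp_neg,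
      Real.exp_log hv]
    change α / V (r, y) 1 = _
    rw [hx, div_eq_mul_inv]
end

section
/- Let a, b_i, c_{ij} (i, j = 1, 2, 3) be C^∞ real functions on a neighborhood of 0 in ℝ⁴, and define h on a punctured neighborhood of 0 in ℝ³ by h(ȳ) := a(|ȳ|, ȳ) + 2 Σ_i b_i(|ȳ|, ȳ) Θ^i + Σ_{i,j} c_{ij}(|ȳ|, ȳ) Θ^i Θ^j, where Θ := ȳ/|ȳ|. Let α > 0, β ∈ ℝ⁴, and let φ : {ȳ ∈ ℝ³ : 0 < |ȳ| < δ} → ℝ be continuous such that for every unit vector Θ ∈ S² the map r ↦ φ(rΘ) is C¹ on (0, δ) with (d/dr) φ(rΘ) = φ(rΘ)² + (1/2) h(rΘ) and φ(rΘ) → α^{−1}(β₀ + Σ_i β_i Θ^i) as r → 0⁺. If, for some k ∈ ℕ, the function ψ(ȳ) := |ȳ| φ(ȳ) is C^k-cone-smooth, then ψ is C^{k+1}-cone-smooth (on a possibly smaller punctured neighborhood of 0). -/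
open Filter Topology MeasureTheory

/-- `ψ`, defined on a punctured neighborhood of `0` in `ℝ³`, is `C^k`-cone-smooth:
it is the trace `ȳ ↦ f(|ȳ|, ȳ)` on the light cone of a `C^k` function `f` defined
on a neighborhood of `0` in `ℝ⁴`. -/
def ConeSmoothC (k : ℕ) (ψ : EuclideanSpace ℝ (Fin 3) → ℝ) : Prop :=
  ∃ (f : ℝ × EuclideanSpace ℝ (Fin 3) → ℝ) (ε : ℝ), 0 < ε ∧
    ContDiffOn ℝ (k : ℕ∞) f (Metric.ball (0 : ℝ × EuclideanSpace ℝ (Fin 3)) ε) ∧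
    ∀ y : EuclideanSpace ℝ (Fin 3), y ≠ 0 → ‖y‖ < ε → f (‖y‖, y) = ψ y

/-- `x ↦ (t ↦ g (t x))` as a map into continuous functions on the unit interval. -/
noncomputable def rayMap {E F : Type} [NormedAddCommGroup E] [NormedSpace ℝ E]
    [NormedAddCommGroup F] [NormedSpace ℝ F] (g : E → F) (hg : Continuous g) (x : E) :
    C(unitInterval, F) :=
  ⟨fun t => g ((t : ℝ) • x), by fun_prop⟩

theorem continuous_rayMap {E F : Type} [NormedAddCommGroup E] [NormedSpace ℝ E]
    [NormedAddCommGroup F] [NormedSpace ℝ F] (g : E → F) (hg : Continuous g) :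
    Continuous (rayMap g hg) := by
  apply ContinuousMap.continuous_of_continuous_uncurry
  change Continuous (fun p : E × unitInterval => g ((p.2 : ℝ) • p.1))
  fun_prop

/-- The operator `G ↦ (v ↦ (t ↦ t • G t v))`. -/
noncomputable def rayOp (E F : Type) [NormedAddCommGroup E] [NormedSpace ℝ E]
    [NormedAddCommGroup F] [NormedSpace ℝ F] :
    C(unitInterval, E →L[ℝ] F) →L[ℝ] (E →L[ℝ] C(unitInterval, F)) :=
  LinearMap.mkContinuous₂
    (LinearMap.mk₂ ℝ (fun (G : C(unitInterval, E →L[ℝ] F)) (v : E) =>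
        (⟨fun t => (t : ℝ) • G t v, by fun_prop⟩ : C(unitInterval, F)))
      (by intros; ext; simp) (by intro c G v; ext t; exact smul_comm (t : ℝ) c (G t v))
      (by intros; ext; simp)
      (by intro c G v; ext t; simp only [map_smul]; exact smul_comm (t : ℝ) c (G t v))) 1 (by
    intro G v
    rw [ContinuousMap.norm_le _ (by positivity)]
    intro t
    have h1 : ‖G t v‖ ≤ ‖G‖ * ‖v‖ :=
      ((G t).le_opNorm v).trans (by gcongr; exact G.norm_coe_le_norm t)
    have h2 : ‖(t : ℝ)‖ ≤ 1 := by
      rw [Real.norm_eq_abs, abs_of_nonneg t.2.1]; exact t.2.2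
    change ‖(t : ℝ) • G t v‖ ≤ _
    rw [norm_smul, one_mul]
    calc ‖(t : ℝ)‖ * ‖G t v‖ ≤ 1 * (‖G‖ * ‖v‖) := by gcongr
      _ = _ := one_mul _)

theorem rayOp_apply {E F : Type} [NormedAddCommGroup E] [NormedSpace ℝ E]
    [NormedAddCommGroup F] [NormedSpace ℝ F] (G : C(unitInterval, E →L[ℝ] F)) (v : E)
    (t : unitInterval) : rayOp E F G v t = (t : ℝ) • G t v := rfl

theorem hasFDerivAt_rayMap {E F : Type} [NormedAddCommGroup E] [NormedSpace ℝ E]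
    [NormedAddCommGroup F] [NormedSpace ℝ F] (g : E → F) (hg : Continuous g)
    (hd : Differentiable ℝ g) (hg' : Continuous (fderiv ℝ g)) (x : E) :
    HasFDerivAt (rayMap g hg) (rayOp E F (rayMap (fderiv ℝ g) hg' x)) x := by
  rw [hasFDerivAt_iff_isLittleO_nhds_zero, Asymptotics.isLittleO_iff]
  intro c hc
  have hcont := (continuous_rayMap (fderiv ℝ g) hg').continuousAt (x := x)
  obtain ⟨η, hη, hball⟩ := Metric.continuousAt_iff.1 hcont c hc
  filter_upwards [Metric.ball_mem_nhds (0 : E) hη] with h hh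
  rw [ContinuousMap.norm_le _ (by positivity)]
  intro t
  change ‖g ((t : ℝ) • (x + h)) - g ((t : ℝ) • x) - (t : ℝ) • (fderiv ℝ g ((t : ℝ) • x)) h‖ ≤ _
  have key := (convex_ball x η).norm_image_sub_le_of_norm_hasFDerivWithin_le'
    (f := fun z => g ((t : ℝ) • z)) (f' := fun z => (t : ℝ) • fderiv ℝ g ((t : ℝ) • z))
    (φ := (t : ℝ) • fderiv ℝ g ((t : ℝ) • x)) (C := c) (x := x) (y := x + h)
    (fun z _ => by
      have h1 : HasFDerivAt (fun z : E => (t : ℝ) • z) ((t : ℝ) • ContinuousLinearMap.id ℝ E) z :=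
        (hasFDerivAt_id z).const_smul (t : ℝ)
      have h2 := ((hd ((t : ℝ) • z)).hasFDerivAt.comp z h1).hasFDerivWithinAt (s := Metric.ball x η)
      refine h2.congr_fderiv ?_
      ext v; simp)
    (fun z hz => by
      have h1 := hball hz
      rw [dist_eq_norm] at h1
      have h2 := ((rayMap (fderiv ℝ g) hg' z - rayMap (fderiv ℝ g) hg' x).norm_coe_le_norm t).trans
        h1.le
      change ‖fderiv ℝ g ((t : ℝ) • z) - fderiv ℝ g ((t : ℝ) • x)‖ ≤ c at h2
      have h3 : ‖(t : ℝ)‖ ≤ 1 := by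
        rw [Real.norm_eq_abs, abs_of_nonneg t.2.1]; exact t.2.2
      rw [← smul_sub, norm_smul]
      calc _ ≤ 1 * c := by gcongr
        _ = c := one_mul c)
    (Metric.mem_ball_self hη) (by simpa using hh)
  simpa using key

theorem contDiff_rayMap (n : ℕ) {E : Type} [NormedAddCommGroup E] [NormedSpace ℝ E]
    [FiniteDimensional ℝ E] :
    ∀ (g : E → ℝ) (hg : Continuous g),
    ContDiff ℝ n g → ContDiff ℝ n (rayMap g hg) := by
  induction n with
  | zero =>
    intro g hg _
    simpa using continuous_rayMap g hg
  | succ n ih =>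
    intro g hg h
    have h' : ContDiff ℝ ((n : WithTop ℕ∞) + 1) g := by exact_mod_cast h
    have hd : Differentiable ℝ g := h'.differentiable (by simp)
    have hf : ContDiff ℝ n (fderiv ℝ g) := (contDiff_succ_iff_fderiv.1 h').2.2
    have hD := hasFDerivAt_rayMap g hg hd hf.continuous
    have : ContDiff ℝ ((n : WithTop ℕ∞) + 1) (rayMap g hg) := by
      rw [contDiff_succ_iff_fderiv]
      refine ⟨fun x => (hD x).differentiableAt, by simp, ?_⟩
      rw [contDiff_clm_apply_iff]
      intro v
      have hv : ContDiff ℝ n (fun z => fderiv ℝ g z v) := hf.clm_apply contDiff_const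
      have e : (fun x => fderiv ℝ (rayMap g hg) x v)
          = fun x => (⟨fun t => (t : ℝ), by fun_prop⟩ : C(unitInterval, ℝ))
            * rayMap (fun z => fderiv ℝ g z v) hv.continuous x := by
        ext1 x
        rw [(hD x).fderiv]
        rfl
      rw [e]
      exact contDiff_const.mul (ih _ hv.continuous hv)
    exact_mod_cast this

/-- Extension by a cutoff. -/
theorem exists_global {E : Type} [NormedAddCommGroup E] [NormedSpace ℝ E]
    [FiniteDimensional ℝ E] (g : E → ℝ) (ε : ℝ) (hε : 0 < ε) (n : ℕ)
    (hg : ContDiffOn ℝ (⊤ : ℕ∞) g (Metric.ball (0 : E) ε)) :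
    ∃ G : E → ℝ, ContDiff ℝ n G ∧ ∀ x, ‖x‖ < ε / 3 → G x = g x := by
  let B : ContDiffBump (0 : E) := ⟨ε / 3, ε / 2, by positivity, by linarith⟩
  refine ⟨fun x => B x * g x, ?_, fun x hx => ?_⟩
  · rw [contDiff_iff_contDiffAt]
    intro x
    by_cases hx : x ∈ Metric.ball (0 : E) ε
    · exact B.contDiff.contDiffAt.mul
        ((hg.contDiffAt (Metric.isOpen_ball.mem_nhds hx)).of_le (by exact_mod_cast le_top))
    · have : (fun x => B x * g x) =ᶠ[𝓝 x] fun _ => 0 := by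
        have : (Metric.closedBall (0 : E) (ε / 2))ᶜ ∈ 𝓝 x := by
          apply Metric.isClosed_closedBall.isOpen_compl.mem_nhds
          simp at hx ⊢
          linarith
        filter_upwards [this] with z hz
        rw [B.zero_of_le_dist, zero_mul]
        simp at hz ⊢
        exact hz.le
      exact contDiffAt_const.congr_of_eventuallyEq this
  · change B x * g x = g x
    rw [B.one_of_mem_closedBall, one_mul]
    simpa using hx.le

/-- The Volterra operator. -/
noncomputable def volterra : C(unitInterval, ℝ) →L[ℝ] C(unitInterval, ℝ) :=
  LinearMap.mkContinuous
    { toFun := fun u => ⟨fun t => ∫ s in (0 : ℝ)..t, Set.IccExtend zero_le_one u s, by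
        have h : Continuous (Set.IccExtend (zero_le_one (α := ℝ)) u) := u.continuous.Icc_extend'
        exact (intervalIntegral.continuous_primitive
          (fun a b => h.intervalIntegrable a b) 0).comp continuous_subtype_val⟩
      map_add' := by
        intro u v
        ext t
        have h : ∀ u : C(unitInterval, ℝ), Continuous (Set.IccExtend (zero_le_one (α := ℝ)) u) :=
          fun u => u.continuous.Icc_extend'
        exact intervalIntegral.integral_add ((h u).intervalIntegrable _ _)
          ((h v).intervalIntegrable _ _)
      map_smul' := by
        intro c u
        ext t
        exact intervalIntegral.integral_const_mul c _ } 1 (by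
    intro u
    rw [ContinuousMap.norm_le _ (by positivity)]
    intro t
    change ‖∫ s in (0 : ℝ)..t, Set.IccExtend zero_le_one u s‖ ≤ _
    refine (intervalIntegral.norm_integral_le_of_norm_le_const (C := ‖u‖)
      (fun s _ => u.norm_coe_le_norm _)).trans ?_
    rw [sub_zero, abs_of_nonneg t.2.1, mul_comm]
    gcongr
    exact t.2.2)

theorem volterra_apply (u : C(unitInterval, ℝ)) (t : unitInterval) :
    volterra u t = ∫ s in (0 : ℝ)..t, Set.IccExtend zero_le_one u s := rfl

/-- Smooth solution operator for `u = w + V (u²)` near `0`. -/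
theorem exists_solution (n : ℕ) : ∃ S : C(unitInterval, ℝ) → C(unitInterval, ℝ),
    ContDiffAt ℝ (n + 1 : ℕ) S 0 ∧ ∀ᶠ w in 𝓝 (0 : C(unitInterval, ℝ)),
      S w = w + volterra (S w ^ 2) := by
  let Φ : C(unitInterval, ℝ) → C(unitInterval, ℝ) := fun u => u - volterra (u ^ 2)
  have hΦ : ContDiff ℝ (n + 1 : ℕ) Φ := contDiff_id.sub (volterra.contDiff.comp (contDiff_id.pow 2))
  have h0 : Φ 0 = 0 := by simp [Φ]
  have hD : HasFDerivAt Φ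
      ((ContinuousLinearEquiv.refl ℝ C(unitInterval, ℝ) : C(unitInterval, ℝ) →L[ℝ] _)) 0 := by
    have h1 : HasFDerivAt (fun u : C(unitInterval, ℝ) => u * u) _ 0 :=
      (hasFDerivAt_id (𝕜 := ℝ) (0 : C(unitInterval, ℝ))).mul (hasFDerivAt_id 0)
    have h2 := (hasFDerivAt_id (𝕜 := ℝ) (0 : C(unitInterval, ℝ))).sub
      (volterra.hasFDerivAt.comp 0 h1)
    have e : Φ = fun u => u - volterra (u * u) := by ext1 u; simp [Φ, pow_two]
    rw [e]
    refine HasFDerivAt.congr_fderiv h2 ?_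
    ext1 v
    simp
  have hn : ((n + 1 : ℕ) : WithTop ℕ∞) ≠ 0 := by
    exact_mod_cast Nat.succ_ne_zero n
  refine ⟨hΦ.contDiffAt.localInverse hD hn, ?_, ?_⟩
  · have := hΦ.contDiffAt.to_localInverse hD hn
    rwa [h0] at this
  · have := (hΦ.contDiffAt.hasStrictFDerivAt' hD hn).eventually_right_inverse
    rw [h0] at this
    filter_upwards [this] with w hw
    exact (sub_eq_iff_eq_add.1 hw)

theorem riccati_unique (u w m : ℝ → ℝ) (hu : Continuous u) (hw : ContinuousOn w (Set.Icc 0 1))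
    (hu' : ∀ t ∈ Set.Ioo (0 : ℝ) 1, HasDerivAt u (u t ^ 2 + m t) t)
    (hw' : ∀ t ∈ Set.Ioo (0 : ℝ) 1, HasDerivAt w (w t ^ 2 + m t) t) (h0 : u 0 = w 0) :
    u 1 = w 1 := by
  let p : ℝ → ℝ := Set.IccExtend (zero_le_one (α := ℝ)) ((Set.Icc (0 : ℝ) 1).domRestrict fun t => u t + w t)
  have hp : Continuous p := by
    apply Continuous.Icc_extend'
    exact (hu.continuousOn.add hw).domRestrict
  have hpt : ∀ t ∈ Set.Ioo (0 : ℝ) 1, p t = u t + w t := fun t ht => by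
    simp only [p]
    rw [Set.IccExtend_of_mem _ _ (Set.Ioo_subset_Icc_self ht)]; rfl
  let P : ℝ → ℝ := fun t => ∫ s in (0 : ℝ)..t, p s
  have hP : ∀ t, HasDerivAt P (p t) t := fun t => hp.integral_hasStrictDerivAt 0 t |>.hasDerivAt
  have hPc : Continuous P := continuous_iff_continuousAt.2 fun t => (hP t).continuousAt
  let d : ℝ → ℝ := fun t => (u t - w t) * Real.exp (-P t)
  have hd : ∀ t ∈ Set.Ioo (0 : ℝ) 1, HasDerivAt d 0 t := by
    intro t ht
    have := ((hu' t ht).sub (hw' t ht)).mul ((hP t).neg.exp)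
    refine HasDerivAt.congr_deriv this ?_
    rw [hpt t ht]
    simp only [Pi.sub_apply]
    ring
  have hdc : ContinuousOn d (Set.Icc 0 1) :=
    (hu.continuousOn.sub hw).mul (Real.continuous_exp.comp hPc.neg).continuousOn
  obtain ⟨t, ht, he⟩ := exists_hasDerivAt_eq_slope d (fun _ => 0) zero_lt_one hdc hd
  have : d 0 = 0 := by simp [d, h0]
  simp only [this, sub_zero, div_one] at he
  have := he.symm
  simp only [d, mul_eq_zero, Real.exp_ne_zero, or_false] at this
  linarith

/-- inductive step of Proposition A.1: if `φ` solves the Riccati equation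
`∂_r φ = φ² + h/2` along the generators with the prescribed limit at the vertex, and if
`ψ = r φ` is `C^k`-cone-smooth, then `ψ` is `C^{k+1}`-cone-smooth. -/
theorem riccati_gain_one_order
    (a : ℝ × EuclideanSpace ℝ (Fin 3) → ℝ)
    (b : Fin 3 → ℝ × EuclideanSpace ℝ (Fin 3) → ℝ)
    (c : Fin 3 → Fin 3 → ℝ × EuclideanSpace ℝ (Fin 3) → ℝ)
    (ε₀ : ℝ) (hε₀ : 0 < ε₀)
    (ha : ContDiffOn ℝ (⊤ : ℕ∞) a (Metric.ball (0 : ℝ × EuclideanSpace ℝ (Fin 3)) ε₀))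
    (hb : ∀ i, ContDiffOn ℝ (⊤ : ℕ∞) (b i)
      (Metric.ball (0 : ℝ × EuclideanSpace ℝ (Fin 3)) ε₀))
    (hc : ∀ i j, ContDiffOn ℝ (⊤ : ℕ∞) (c i j)
      (Metric.ball (0 : ℝ × EuclideanSpace ℝ (Fin 3)) ε₀))
    (α : ℝ) (hα : 0 < α) (β : Fin 4 → ℝ)
    (δ : ℝ) (hδ : 0 < δ) (hδε : δ ≤ ε₀)
    (φ : EuclideanSpace ℝ (Fin 3) → ℝ)
    (hφc : ContinuousOn φ {y : EuclideanSpace ℝ (Fin 3) | y ≠ 0 ∧ ‖y‖ < δ})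
    (hode : ∀ Θ : EuclideanSpace ℝ (Fin 3), ‖Θ‖ = 1 →
      ∀ r ∈ Set.Ioo (0 : ℝ) δ,
        HasDerivAt (fun t : ℝ => φ (t • Θ))
          ((φ (r • Θ)) ^ 2 + (1 / 2) * coneSource a b c (r • Θ)) r)
    (hlim : ∀ Θ : EuclideanSpace ℝ (Fin 3), ‖Θ‖ = 1 →
      Tendsto (fun r : ℝ => φ (r • Θ)) (𝓝[>] (0 : ℝ))
        (𝓝 (α⁻¹ * (β 0 + ∑ i : Fin 3, β i.succ * Θ i))))
    (k : ℕ)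
    (hk : ConeSmoothC k (fun y => ‖y‖ * φ y)) :
    ConeSmoothC (k + 1) (fun y => ‖y‖ * φ y) := by
  classical
  have hn : ∀ i, ContDiff ℝ (k + 1 : ℕ)
      (fun x : ℝ × EuclideanSpace ℝ (Fin 3) => x.2 i) := by
    intro i; fun_prop
  obtain ⟨A, hA, hAa⟩ := exists_global a ε₀ hε₀ (k + 1) ha
  choose B hB hBb using fun i => exists_global (b i) ε₀ hε₀ (k + 1) (hb i)
  choose C hC hCc using fun i j => exists_global (c i j) ε₀ hε₀ (k + 1) (hc i j)
  let κ : ℝ × EuclideanSpace ℝ (Fin 3) → C(unitInterval, ℝ) := fun x =>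
    x.1 ^ 2 • rayMap A hA.continuous x
      + (2 : ℝ) • ∑ i, (x.1 * x.2 i) • rayMap (B i) (hB i).continuous x
      + ∑ i, ∑ j, (x.2 i * x.2 j) • rayMap (C i j) (hC i j).continuous x
  have hκ : ContDiff ℝ (k + 1 : ℕ) κ := by
    have h1 : ContDiff ℝ (k + 1 : ℕ) (fun x : ℝ × EuclideanSpace ℝ (Fin 3) => x.1) :=
      contDiff_fst
    refine (((h1.pow 2).smul (contDiff_rayMap _ _ _ hA)).add
      ((ContDiff.sum fun i _ =>
        (h1.mul (hn i)).smul (contDiff_rayMap _ _ _ (hB i))).const_smul (2 : ℝ))).add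
      (ContDiff.sum fun i _ => ContDiff.sum fun j _ =>
        ((hn i).mul (hn j)).smul (contDiff_rayMap _ _ _ (hC i j)))
  let l : ℝ × EuclideanSpace ℝ (Fin 3) → ℝ := fun x =>
    α⁻¹ * (β 0 * x.1 + ∑ i : Fin 3, β i.succ * x.2 i)
  have hl : ContDiff ℝ (k + 1 : ℕ) l := by
    refine contDiff_const.mul ((contDiff_const.mul contDiff_fst).add
      (ContDiff.sum fun i _ => contDiff_const.mul (hn i)))
  let W : ℝ × EuclideanSpace ℝ (Fin 3) → C(unitInterval, ℝ) := fun x =>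
    l x • (1 : C(unitInterval, ℝ)) + volterra ((1 / 2 : ℝ) • κ x)
  have hW : ContDiff ℝ (k + 1 : ℕ) W :=
    (hl.smul contDiff_const).add (volterra.contDiff.comp (hκ.const_smul (1 / 2 : ℝ)))
  have hW0 : W 0 = 0 := by simp [W, l, κ]
  obtain ⟨S, hS, hSw⟩ := exists_solution k
  let f : ℝ × EuclideanSpace ℝ (Fin 3) → ℝ := fun x => S (W x) 1
  have hf : ContDiffAt ℝ (k + 1 : ℕ) f 0 := by
    have h1 : ContDiffAt ℝ (k + 1 : ℕ) (fun x => S (W x)) 0 := by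
      refine ContDiffAt.comp (g := S) 0 ?_ hW.contDiffAt
      rw [hW0]; exact hS
    exact (ContinuousMap.evalCLM ℝ (1 : unitInterval)).contDiff.contDiffAt.comp _ h1
  have hev : ∀ᶠ x in 𝓝 (0 : ℝ × EuclideanSpace ℝ (Fin 3)),
      S (W x) = W x + volterra (S (W x) ^ 2) := by
    have : Tendsto W (𝓝 0) (𝓝 0) := by
      have := hW.continuous.tendsto 0
      rwa [hW0] at this
    exact this.eventually hSw
  obtain ⟨u, hu, hfu⟩ := hf.contDiffOn le_rfl (by simp)
  obtain ⟨ε₁, hε₁, hb₁⟩ := Metric.mem_nhds_iff.1 hu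
  obtain ⟨ε₂, hε₂, hb₂⟩ := Metric.mem_nhds_iff.1 hev
  refine ⟨f, min (min ε₁ ε₂) (min (ε₀ / 3) δ), by positivity, ?_, ?_⟩
  · refine ContDiffOn.mono (s := u) (by simpa using hfu) ?_
    refine subset_trans (Metric.ball_subset_ball ?_) (by simpa using hb₁)
    exact (min_le_left _ _).trans (min_le_left _ _)
  intro y hy0 hy
  simp only [lt_min_iff] at hy
  obtain ⟨⟨-, hy2⟩, hy3, hyδ⟩ := hy
  have hr : 0 < ‖y‖ := norm_pos_iff.2 hy0
  set r := ‖y‖ with hrdef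
  have hnx : ‖((r, y) : ℝ × EuclideanSpace ℝ (Fin 3))‖ = r := by
    simp [Prod.norm_def, hrdef]
  have hsol : S (W (r, y)) = W (r, y) + volterra (S (W (r, y)) ^ 2) := by
    apply hb₂
    rw [mem_ball_zero_iff, hnx]; exact hy2
  let Θ : EuclideanSpace ℝ (Fin 3) := r⁻¹ • y
  have hΘ : ‖Θ‖ = 1 := by
    simp only [Θ]
    rw [norm_smul, norm_inv, norm_norm, inv_mul_cancel₀ hr.ne']
  have hΘy : ∀ t : ℝ, (t * r) • Θ = t • y := by
    intro t
    simp only [Θ]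
    rw [smul_smul, mul_assoc, mul_inv_cancel₀ hr.ne', mul_one]
  let v := S (W (r, y))
  let m : C(unitInterval, ℝ) := (1 / 2 : ℝ) • κ (r, y)
  let U : ℝ → ℝ := fun t => l (r, y) + ∫ s in (0 : ℝ)..t,
    (Set.IccExtend zero_le_one m s + Set.IccExtend zero_le_one (v ^ 2 : C(unitInterval, ℝ)) s)
  have hcI : ∀ q : C(unitInterval, ℝ), Continuous (Set.IccExtend (zero_le_one (α := ℝ)) q) :=
    fun q => q.continuous.Icc_extend'
  have hUv : ∀ t (ht : t ∈ Set.Icc (0 : ℝ) 1), U t = v ⟨t, ht⟩ := by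
    intro t ht
    have h1 : v ⟨t, ht⟩ = (W (r, y) + volterra (v ^ 2)) ⟨t, ht⟩ := by
      exact congrArg (fun q : C(unitInterval, ℝ) => q ⟨t, ht⟩) hsol
    rw [h1]
    simp only [W, ContinuousMap.add_apply, volterra_apply, ContinuousMap.smul_apply,
      ContinuousMap.one_apply, smul_eq_mul, mul_one, U]
    rw [intervalIntegral.integral_add ((hcI _).intervalIntegrable _ _)
      ((hcI _).intervalIntegrable _ _)]
    ring
  have hU' : ∀ t, HasDerivAt U (Set.IccExtend zero_le_one m t
      + Set.IccExtend zero_le_one (v ^ 2 : C(unitInterval, ℝ)) t) t := by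
    intro t
    exact (((hcI m).add (hcI (v ^ 2))).integral_hasStrictDerivAt 0 t).hasDerivAt.const_add _
  have hUc : Continuous U := continuous_iff_continuousAt.2 fun t => (hU' t).continuousAt
  have hm : ∀ t ∈ Set.Ioo (0 : ℝ) 1, Set.IccExtend zero_le_one m t
      = r ^ 2 * ((1 / 2) * coneSource a b c (t • y)) := by
    intro t ht
    rw [Set.IccExtend_of_mem _ _ (Set.Ioo_subset_Icc_self ht)]
    have hnt : ‖t • y‖ = t * r := by rw [norm_smul, Real.norm_of_nonneg ht.1.le]
    have hsm : (t • ((r, y) : ℝ × EuclideanSpace ℝ (Fin 3))) = (t * r, t • y) := rfl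
    have hlt : ‖((t * r, t • y) : ℝ × EuclideanSpace ℝ (Fin 3))‖ < ε₀ / 3 := by
      rw [← hsm, norm_smul, hnx, Real.norm_of_nonneg ht.1.le]
      nlinarith [ht.1, ht.2]
    have hdiv : ∀ i, (t • y) i / (t * r) = y i / r := by
      intro i
      have := ht.1.ne'
      simp only [PiLp.smul_apply, smul_eq_mul]
      field_simp
    have eA : rayMap A hA.continuous (r, y) ⟨t, Set.Ioo_subset_Icc_self ht⟩ = a (t * r, t • y) :=
      hAa _ hlt
    have eB : ∀ i, rayMap (B i) (hB i).continuous (r, y) ⟨t, Set.Ioo_subset_Icc_self ht⟩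
        = b i (t * r, t • y) := fun i => hBb i _ hlt
    have eC : ∀ i j, rayMap (C i j) (hC i j).continuous (r, y) ⟨t, Set.Ioo_subset_Icc_self ht⟩
        = c i j (t * r, t • y) := fun i j => hCc i j _ hlt
    simp only [m, κ, coneSource, hnt, hdiv, ContinuousMap.add_apply, ContinuousMap.smul_apply,
      eA, eB, eC, smul_eq_mul, Fin.sum_univ_three]
    field_simp
  let w : ℝ → ℝ := fun t => if t ≤ 0 then l (r, y) else r * φ (t • y)
  have hweq : ∀ t, 0 < t → w =ᶠ[𝓝 t] fun s => r * φ (s • y) := by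
    intro t ht
    filter_upwards [lt_mem_nhds ht] with s hs
    simp [w, not_le.2 hs]
  have hwd : ∀ t, 0 < t → t ≤ 1 → HasDerivAt w
      (r * (((φ (t • y)) ^ 2 + (1 / 2) * coneSource a b c (t • y)) * r)) t := by
    intro t ht ht1
    refine HasDerivAt.congr_of_eventuallyEq ?_ (hweq t ht)
    have h1 := hode Θ hΘ (t * r) ⟨by positivity, by nlinarith⟩
    rw [hΘy] at h1
    have h2 : HasDerivAt (fun s : ℝ => s * r) r t := by
      simpa using (hasDerivAt_id t).mul_const r
    have h3 := (HasDerivAt.comp t h1 h2).const_mul r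
    simpa only [Function.comp_def, hΘy] using h3
  have hw0 : w 0 = l (r, y) := by simp [w]
  have hwc : ContinuousOn w (Set.Icc 0 1) := by
    intro t ht
    rcases ht.1.eq_or_lt with h | h
    · subst h
      have h1 := (hlim Θ hΘ).const_mul r
      have h2 : Tendsto (fun t : ℝ => t * r) (𝓝[>] 0) (𝓝[>] 0) := by
        refine tendsto_nhdsWithin_iff.2 ⟨?_, ?_⟩
        · have : Continuous fun t : ℝ => t * r := by fun_prop
          have := (this.tendsto 0).mono_left (nhdsWithin_le_nhds (s := Set.Ioi 0))
          simpa using this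
        · filter_upwards [self_mem_nhdsWithin] with t ht
          exact mul_pos ht hr
      have h3 := h1.comp h2
      have h4 : r * (α⁻¹ * (β 0 + ∑ i : Fin 3, β i.succ * Θ i)) = w 0 := by
        rw [hw0]
        simp only [l, Θ, PiLp.smul_apply, smul_eq_mul, Fin.sum_univ_three]
        field_simp
      rw [h4] at h3
      have h5 : Tendsto w (𝓝[>] 0) (𝓝 (w 0)) := by
        refine h3.congr' ?_
        filter_upwards [self_mem_nhdsWithin] with t ht
        simp only [Function.comp_def, hΘy, w, not_le.2 (Set.mem_Ioi.1 ht), if_false]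
      have h6 : ContinuousWithinAt w (Set.Ici 0) 0 := continuousWithinAt_Ioi_iff_Ici.1 h5
      exact h6.mono Set.Icc_subset_Ici_self
    · exact (hwd t h ht.2).continuousAt.continuousWithinAt
  have key := riccati_unique U w (Set.IccExtend zero_le_one m) hUc hwc
    (fun t ht => by
      refine (hU' t).congr_deriv ?_
      rw [hUv t (Set.Ioo_subset_Icc_self ht),
        Set.IccExtend_of_mem _ (v ^ 2 : C(unitInterval, ℝ)) (Set.Ioo_subset_Icc_self ht)]
      simp only [ContinuousMap.pow_apply]
      ring)
    (fun t ht => by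
      refine (hwd t ht.1 ht.2.le).congr_deriv ?_
      rw [hm t ht]
      simp only [w, not_le.2 ht.1, if_false]
      ring)
    (by rw [hw0]; simp [U])
  have hfU : f (r, y) = U 1 := (hUv 1 (by simp)).symm
  rw [hfU, key]
  simp only [w, not_le.2 (zero_lt_one (α := ℝ)), if_false, one_smul]
  rfl
end
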